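/- arXiv:2305.07177 — 3 statements merged into one kernel-verified Lean document; each statement's English description precedes it below -/
import Mathlib

section
/- Let q > 3 be a prime and let A be a finite non-metacyclic q-group. Then A contains a subgroup of exponent q and order q^3. -/
/-- A group is metacyclic if it has a cyclic normal subgroup with cyclic quotient.
(Using normality of `N`, cyclicity of the quotient `A ⧸ N` is expressed by the existence of a
single element `g` with `N ⊔ ⟨g⟩ = ⊤`.) -/
def IsMetacyclic (A : Type*) [Group A] : Prop :=
  ∃ N : Subgroup A, N.Normal ∧ IsCyclic N ∧ ∃ g : A, N ⊔ Subgroup.zpowers g = ⊤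

namespace QG

open scoped commutatorElement

lemma pow_formula {G : Type*} [Group G] (b u c d : G) (h1 : u * b = b * (u * c))
    (h2 : c * b = b * (c * d)) (h3 : Commute b d) (huc : Commute u c) (hud : Commute u d)
    (hcd : Commute c d) (n : ℕ) :
    (b * u) ^ n = b ^ n * (u ^ n * (c ^ (n.choose 2) * d ^ (n.choose 3))) := by
  have s1 : SemiconjBy b (u * c) u := h1.symm
  have s2 : SemiconjBy b (c * d) c := h2.symm
  have s3 : SemiconjBy b d d := h3
  induction n with
  | zero => simp
  | succ n ih =>
    have t := ((s1.pow_right n).mul_right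
      ((s2.pow_right (n.choose 2)).mul_right (s3.pow_right (n.choose 3)))).eq
    rw [pow_succ, ih, mul_assoc, ← mul_assoc _ b u, ← t, huc.mul_pow, hcd.mul_pow]
    have e2 : (n+1).choose 2 = n + n.choose 2 := by
      rw [Nat.choose_succ_succ' n 1]; simp
    have e3 : (n+1).choose 3 = n.choose 2 + n.choose 3 := Nat.choose_succ_succ' n 2
    rw [e2, e3, pow_succ, pow_succ, pow_add, pow_add]
    have k1 : Commute (c ^ n) u := (huc.pow_right n).symm
    have k2 : Commute (c ^ (n.choose 2)) u := (huc.pow_right _).symm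
    have k3 : Commute (d ^ (n.choose 2)) u := (hud.pow_right _).symm
    have k4 : Commute (d ^ (n.choose 3)) u := (hud.pow_right _).symm
    simp only [mul_assoc]
    rw [k4.eq, ← mul_assoc _ u, k3.eq, mul_assoc, ← mul_assoc _ u, k2.eq, mul_assoc,
      ← mul_assoc _ u, k1.eq, mul_assoc]

lemma exists_sub {G : Type*} [Group G] [Finite G] {p : ℕ} (hp : p.Prime) (hG : IsPGroup p G)
    {n : ℕ} (h : p ^ n ≤ Nat.card G) : ∃ B : Subgroup G, Nat.card B = p ^ n := by
  have := Fact.mk hp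
  obtain ⟨m, hm⟩ := IsPGroup.iff_card.mp hG
  apply Sylow.exists_subgroup_card_pow_prime
  rw [hm] at h ⊢
  exact pow_dvd_pow _ ((Nat.pow_le_pow_iff_right hp.one_lt).mp h)

/-- groups of order at most `p^2` -/
lemma comm_of_small {G : Type*} [Group G] [Finite G] {p : ℕ} (hp : p.Prime) (hG : IsPGroup p G)
    (h : Nat.card G ≤ p ^ 2) (x y : G) : x * y = y * x := by
  have := Fact.mk hp
  obtain ⟨m, hm⟩ := IsPGroup.iff_card.mp hG
  rw [hm] at h
  have : m ≤ 2 := (Nat.pow_le_pow_iff_right hp.one_lt).mp h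
  interval_cases m
  · have : Subsingleton G := (Nat.card_eq_one_iff_unique.mp (by simpa using hm)).1
    exact Subsingleton.elim _ _
  · have : IsCyclic G := isCyclic_of_prime_card (p := p) (by simpa using hm)
    exact (IsCyclic.commGroup (α := G)).mul_comm x y
  · exact (IsPGroup.commGroupOfCardEqPrimeSq (p := p) hm).mul_comm x y

lemma gen_of_small {G : Type*} [Group G] [Finite G] {p : ℕ} (hp : p.Prime) (hG : IsPGroup p G)
    (h : Nat.card G ≤ p ^ 2) (c : G) (hc : c ≠ 1) :
    ∃ g : G, Subgroup.zpowers c ⊔ Subgroup.zpowers g = ⊤ := by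
  have := Fact.mk hp
  by_cases ht : Subgroup.zpowers c = ⊤
  · exact ⟨1, by simp [ht]⟩
  obtain ⟨g, hg⟩ : ∃ g, g ∉ Subgroup.zpowers c := by
    by_contra hcon
    push Not at hcon
    exact ht ((Subgroup.eq_top_iff' _).mpr hcon)
  refine ⟨g, ?_⟩
  set H := Subgroup.zpowers c ⊔ Subgroup.zpowers g
  have hlt : Subgroup.zpowers c < H := by
    refine lt_of_le_of_ne le_sup_left ?_
    intro he
    apply hg
    rw [he]
    exact (le_sup_right : Subgroup.zpowers g ≤ H) (Subgroup.mem_zpowers g)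
  obtain ⟨k, hk⟩ := IsPGroup.iff_card.mp (hG.to_subgroup (Subgroup.zpowers c))
  obtain ⟨l, hl⟩ := IsPGroup.iff_card.mp (hG.to_subgroup H)
  have h1 : Nat.card (Subgroup.zpowers c) < Nat.card H :=
    Set.Finite.card_lt_card (Set.toFinite _) hlt
  have hk0 : k ≠ 0 := by
    rintro rfl
    rw [pow_zero, Subgroup.card_eq_one, Subgroup.zpowers_eq_bot] at hk
    exact hc hk
  rw [hk, hl] at h1
  have h2 : k < l := (Nat.pow_lt_pow_iff_right hp.one_lt).mp h1
  apply Subgroup.eq_top_of_le_card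
  rw [hl]
  exact h.trans (Nat.pow_le_pow_right hp.pos (by omega))


lemma ker_big {G : Type*} [Group G] [Finite G] {p : ℕ} (hp : p.Prime) (hG : IsPGroup p G)
    (f : G →* G) (hf : ∀ x, f x = x ^ p) (h : p ^ 3 ≤ Nat.card f.ker) :
    ∃ B : Subgroup G, Nat.card B = p ^ 3 ∧ ∀ b ∈ B, b ^ p = 1 := by
  obtain ⟨B, hB⟩ := exists_sub hp (hG.to_subgroup f.ker) h
  refine ⟨B.map f.ker.subtype, ?_, ?_⟩
  · rw [Subgroup.card_map_of_injective f.ker.subtype_injective, hB]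
  · rintro _ ⟨b, -, rfl⟩
    have := b.2
    rw [MonoidHom.mem_ker, hf] at this
    exact this

lemma comm_gen' {G : Type*} [Group G] (N : Subgroup G) (hN : N ≤ Subgroup.center G) (a b : G)
    (hab : a * b = b * a) (x y : G) (hx : x ∈ N ⊔ Subgroup.zpowers a ⊔ Subgroup.zpowers b)
    (hy : y ∈ N ⊔ Subgroup.zpowers a ⊔ Subgroup.zpowers b) :
    x * y = y * x := by
  set H := N ⊔ Subgroup.zpowers a ⊔ Subgroup.zpowers b with hH
  have key : ∀ c : G, c * a = a * c → c * b = b * c → H ≤ Subgroup.centralizer {c} := by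
    intro c h1 h2
    refine sup_le (sup_le ?_ ?_) ?_
    · exact hN.trans (Subgroup.center_le_centralizer _)
    · rw [Subgroup.zpowers_le, Subgroup.mem_centralizer_singleton_iff]; exact h1.symm
    · rw [Subgroup.zpowers_le, Subgroup.mem_centralizer_singleton_iff]; exact h2.symm
  have h1 := Subgroup.mem_centralizer_singleton_iff.mp (key a rfl hab hx)
  have h2 := Subgroup.mem_centralizer_singleton_iff.mp (key b hab.symm rfl hx)
  exact (Subgroup.mem_centralizer_singleton_iff.mp (key x h1 h2 hy)).symm

lemma comm_gen {G : Type*} [Group G] (N : Subgroup G) (hN : N ≤ Subgroup.center G) (a b : G)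
    (hab : a * b = b * a) (hgen : N ⊔ Subgroup.zpowers a ⊔ Subgroup.zpowers b = ⊤) (x y : G) :
    x * y = y * x :=
  comm_gen' N hN a b hab x y (by rw [hgen]; trivial) (by rw [hgen]; trivial)

lemma mk_comm_iff {G : Type*} [Group G] (W : Subgroup G) [W.Normal] (x y : G) :
    (QuotientGroup.mk' W x * QuotientGroup.mk' W y = QuotientGroup.mk' W y * QuotientGroup.mk' W x)
      ↔ ⁅x, y⁆ ∈ W := by
  rw [← commutatorElement_eq_one_iff_mul_comm, ← map_commutatorElement, ← MonoidHom.mem_ker,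
    QuotientGroup.ker_mk']

lemma comm_mem {G : Type*} [Group G] (W N : Subgroup G) [W.Normal]
    (hN : ∀ n ∈ N, ∀ g : G, ⁅g, n⁆ ∈ W) (a b : G) (hab : ⁅a, b⁆ ∈ W)
    (hgen : N ⊔ Subgroup.zpowers a ⊔ Subgroup.zpowers b = ⊤) (x y : G) : ⁅x, y⁆ ∈ W := by
  rw [← mk_comm_iff] at hab ⊢
  refine comm_gen (N.map (QuotientGroup.mk' W)) ?_ _ _ hab ?_ _ _
  · rintro _ ⟨n, hn, rfl⟩
    rw [Subgroup.mem_center_iff]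
    intro g
    obtain ⟨g, rfl⟩ := QuotientGroup.mk'_surjective W g
    rw [mk_comm_iff]
    exact hN n hn g
  · rw [← MonoidHom.map_zpowers, ← MonoidHom.map_zpowers, ← Subgroup.map_sup, ← Subgroup.map_sup,
      hgen, Subgroup.map_top_of_surjective _ (QuotientGroup.mk'_surjective W)]

lemma normal_of_comm {G : Type*} [Group G] (H : Subgroup G) (h : ∀ x y : G, ⁅x, y⁆ ∈ H) : H.Normal := by
  constructor
  intro n hn g
  have : g * n * g⁻¹ = ⁅g, n⁆ * n := by simp [commutatorElement_def]
  rw [this]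
  exact H.mul_mem (h _ _) hn

/-- lifting generators modulo `U` -/
lemma lift_gen {G : Type*} [Group G] (U : Subgroup G) [U.Normal] (a b : G)
    (h : Subgroup.zpowers (QuotientGroup.mk' U a) ⊔ Subgroup.zpowers (QuotientGroup.mk' U b) = ⊤) :
    U ⊔ Subgroup.zpowers a ⊔ Subgroup.zpowers b = ⊤ := by
  rw [← MonoidHom.map_zpowers, ← MonoidHom.map_zpowers, ← Subgroup.map_sup] at h
  have := congrArg (Subgroup.comap (QuotientGroup.mk' U)) h
  rw [Subgroup.comap_map_eq, QuotientGroup.ker_mk', Subgroup.comap_top] at this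
  rw [← this, sup_assoc, sup_comm]

/-- subgroup containing commutators, supplementing p-th powers, is everything -/
lemma top_of_pow {G : Type*} [Group G] {p : ℕ} (hG : IsPGroup p G) [Finite G] (hp : p.Prime)
    (H : Subgroup G) [H.Normal]
    (h : ∀ x : G, ∃ y : G, QuotientGroup.mk' H x = QuotientGroup.mk' H y ^ p) : H = ⊤ := by
  have key : ∀ n : ℕ, ∀ x : G, ∃ y : G, QuotientGroup.mk' H x = QuotientGroup.mk' H y ^ (p ^ n) := by
    intro n
    induction n with
    | zero => intro x; exact ⟨x, by simp⟩
    | succ n ih =>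
      intro x
      obtain ⟨y, hy⟩ := h x
      obtain ⟨z, hz⟩ := ih y
      exact ⟨z, by rw [hy, hz, ← pow_mul, pow_succ]⟩
  have := Fact.mk hp
  obtain ⟨m, hm⟩ := IsPGroup.iff_card.mp hG
  rw [Subgroup.eq_top_iff']
  intro x
  obtain ⟨y, hy⟩ := key m x
  rw [← map_pow, ← hm, pow_card_eq_one', map_one, ← MonoidHom.mem_ker, QuotientGroup.ker_mk'] at hy
  exact hy

lemma class_two {G : Type*} [Group G] [Finite G] {p : ℕ} (hp : p.Prime) (hp2 : p ≠ 2)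
    (hG : IsPGroup p G) (hc : ∀ x y : G, ⁅x, y⁆ ∈ Subgroup.center G)
    (he : ∀ x y : G, ⁅x, y⁆ ^ p = 1) :
    IsMetacyclic G ∨ ∃ B : Subgroup G, Nat.card B = p ^ 3 ∧ ∀ b ∈ B, b ^ p = 1 := by
  have := Fact.mk hp
  have cen : ∀ x y z : G, Commute z ⁅x, y⁆ := fun x y z => Subgroup.mem_center_iff.mp (hc x y) z
  have hpow : ∀ x y : G, (x * y) ^ p = x ^ p * y ^ p := by
    intro x y
    have e : ⁅y⁻¹, x⁻¹⁆ = y⁻¹ * x⁻¹ * y * x := by simp [commutatorElement_def]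
    rw [pow_formula x y ⁅y⁻¹, x⁻¹⁆ 1 (by rw [e]; group)
      (by rw [mul_one]; exact (cen _ _ _).symm) (Commute.one_right _) (cen _ _ _)
      (Commute.one_right _) (Commute.one_right _)]
    obtain ⟨k, hk⟩ : p ∣ p.choose 2 :=
      hp.dvd_choose_self two_ne_zero (lt_of_le_of_ne hp.two_le hp2.symm)
    rw [hk, pow_mul, he]
    simp
  let f : G →* G := MonoidHom.mk' (fun x => x ^ p) hpow
  have hf : ∀ x, f x = x ^ p := fun x => rfl
  by_cases hbig : p ^ 3 ≤ Nat.card f.ker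
  · exact Or.inr (ker_big hp hG f hf hbig)
  left
  set U := f.range with hU
  have hUc : U ≤ Subgroup.center G := by
    rintro _ ⟨x, rfl⟩
    rw [Subgroup.mem_center_iff]
    intro g
    have h1 : g * x * g⁻¹ = ⁅g, x⁆ * x := by simp [commutatorElement_def]
    have h2 : g * x ^ p * g⁻¹ = x ^ p := by
      rw [← conj_pow, h1, hpow, he, one_mul]
    rw [hf]
    exact (mul_inv_eq_iff_eq_mul.mp h2)
  have hUn : U.Normal := ⟨fun n hn g => by
    rw [Subgroup.mem_center_iff.mp (hUc hn) g]; simpa using hn⟩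
  have hcard : Nat.card (G ⧸ U) ≤ p ^ 2 := by
    have h1 : Nat.card (G ⧸ U) = Nat.card f.ker := by
      have a1 := Subgroup.card_eq_card_quotient_mul_card_subgroup U
      have a2 := Subgroup.card_eq_card_quotient_mul_card_subgroup f.ker
      have a3 : Nat.card (G ⧸ f.ker) = Nat.card U :=
        Nat.card_congr (QuotientGroup.quotientKerEquivRange f).toEquiv
      rw [a3, a1, mul_comm] at a2
      exact Nat.eq_of_mul_eq_mul_left Nat.card_pos a2
    rw [h1]
    obtain ⟨m, hm⟩ := IsPGroup.iff_card.mp (hG.to_subgroup f.ker)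
    rw [hm] at hbig ⊢
    rw [Nat.pow_le_pow_iff_right hp.one_lt] at hbig
    exact Nat.pow_le_pow_right hp.pos (by omega)
  have hGU : IsPGroup p (G ⧸ U) := hG.to_quotient U
  by_cases hsub : U = ⊤
  · have : (⊥ : Subgroup G) = ⊤ := by
      apply top_of_pow hG hp
      intro x
      have : x ∈ U := by rw [hsub]; trivial
      obtain ⟨y, hy⟩ := this
      exact ⟨y, by rw [← hy, hf, map_pow]⟩
    refine ⟨⊥, inferInstance, inferInstance, 1, ?_⟩
    rw [← this]; simp
  obtain ⟨a, ha⟩ : ∃ a, a ∉ U := by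
    by_contra hcon
    push Not at hcon
    exact hsub ((Subgroup.eq_top_iff' _).mpr hcon)
  have mkne : ∀ a, a ∉ U → QuotientGroup.mk' U a ≠ 1 := by
    intro a ha h
    rw [← MonoidHom.mem_ker, QuotientGroup.ker_mk'] at h
    exact ha h
  have gen : ∀ a, a ∉ U → ∃ b, U ⊔ Subgroup.zpowers a ⊔ Subgroup.zpowers b = ⊤ := by
    intro a ha
    obtain ⟨b, hb⟩ := gen_of_small hp hGU hcard _ (mkne a ha)
    obtain ⟨b, rfl⟩ := QuotientGroup.mk'_surjective U b
    exact ⟨b, lift_gen U a b hb⟩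
  obtain ⟨b, hb⟩ := gen a ha
  set w := ⁅a, b⁆ with hw
  have hWn : (Subgroup.zpowers w).Normal := ⟨fun n hn g => by
    have : n ∈ Subgroup.center G := by
      have : Subgroup.zpowers w ≤ Subgroup.center G := by
        rw [Subgroup.zpowers_le]; exact hc a b
      exact this hn
    rw [Subgroup.mem_center_iff.mp this g]; simpa using hn⟩
  have hW : ∀ x y : G, ⁅x, y⁆ ∈ Subgroup.zpowers w := by
    apply comm_mem _ U _ a b (Subgroup.mem_zpowers w) hb
    intro n hn g
    rw [commutatorElement_eq_one_iff_mul_comm.mpr (Subgroup.mem_center_iff.mp (hUc hn) g)]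
    exact one_mem _
  obtain ⟨c, hcU, hcw⟩ : ∃ c, c ∉ U ∧ w ∈ Subgroup.zpowers c := by
    by_cases hw1 : w = 1
    · exact ⟨a, ha, by rw [hw1]; exact one_mem _⟩
    obtain ⟨c, hcS, hmax⟩ := Set.exists_max_image {c : G | w ∈ Subgroup.zpowers c} orderOf
      (Set.toFinite _) ⟨w, Subgroup.mem_zpowers w⟩
    refine ⟨c, ?_, hcS⟩
    rintro ⟨d, hd⟩
    rw [hf] at hd
    have hdS : w ∈ Subgroup.zpowers d := by
      have : Subgroup.zpowers c ≤ Subgroup.zpowers d := by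
        rw [Subgroup.zpowers_le, ← hd]
        exact Subgroup.npow_mem_zpowers d p
      exact this hcS
    have h1 := hmax d hdS
    have hd1 : d ≠ 1 := by
      rintro rfl
      simp at hdS
      exact hw1 hdS
    have hpd : p ∣ orderOf d := by
      obtain ⟨k, hk⟩ := IsPGroup.iff_orderOf.mp hG d
      rw [hk]
      apply dvd_pow_self
      rintro rfl
      rw [pow_zero, orderOf_eq_one_iff] at hk
      exact hd1 hk
    rw [← hd, orderOf_pow_of_dvd hp.ne_zero hpd] at h1
    exact absurd h1 (not_le.mpr (Nat.div_lt_self (orderOf_pos d) hp.one_lt))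
  have hcle : Subgroup.zpowers w ≤ Subgroup.zpowers c := by
    rwa [Subgroup.zpowers_le]
  obtain ⟨g, hg⟩ := gen c hcU
  refine ⟨Subgroup.zpowers c, normal_of_comm _ (fun x y => hcle (hW x y)), inferInstance, g, ?_⟩
  have hHn : (Subgroup.zpowers c ⊔ Subgroup.zpowers g).Normal :=
    normal_of_comm _ (fun x y => (hcle.trans le_sup_left) (hW x y))
  apply top_of_pow hG hp
  intro x
  have hx : x ∈ U ⊔ (Subgroup.zpowers c ⊔ Subgroup.zpowers g) := by
    rw [← sup_assoc, hg]; trivial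
  rw [Subgroup.mem_sup_of_normal_right] at hx
  obtain ⟨_, ⟨y, rfl⟩, h, hh, rfl⟩ := hx
  refine ⟨y, ?_⟩
  rw [map_mul, hf, map_pow]
  have : QuotientGroup.mk' (Subgroup.zpowers c ⊔ Subgroup.zpowers g) h = 1 := by
    rw [← MonoidHom.mem_ker, QuotientGroup.ker_mk']; exact hh
  rw [this, mul_one]

lemma ker_card {G : Type*} [Group G] [Finite G] {p : ℕ} (hp : p.Prime) (hG : Nat.card G = p ^ 4)
    (Z : Subgroup G) (hZ : Nat.card Z = p) (f : G →* G) (hf : ∀ x, f x ∈ Z) :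
    p ^ 3 ≤ Nat.card f.ker := by
  have a2 := Subgroup.card_eq_card_quotient_mul_card_subgroup f.ker
  have a3 : Nat.card (G ⧸ f.ker) = Nat.card f.range :=
    Nat.card_congr (QuotientGroup.quotientKerEquivRange f).toEquiv
  have a4 : Nat.card f.range ≤ p := by
    rw [← hZ]
    apply Nat.le_of_dvd Nat.card_pos
    apply Subgroup.card_dvd_of_le
    rintro _ ⟨x, rfl⟩
    exact hf x
  rw [hG, a3] at a2
  have : p * p ^ 3 ≤ p * Nat.card f.ker := by
    calc p * p ^ 3 = p ^ 4 := by ring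
      _ = _ := a2
      _ ≤ _ := Nat.mul_le_mul_right _ a4
  exact Nat.le_of_mul_le_mul_left this hp.pos

lemma order_four {G : Type*} [Group G] [Finite G] {p : ℕ} (hp : p.Prime) (hp3 : 3 < p)
    (hG : Nat.card G = p ^ 4) (Z : Subgroup G) (hZc : Z ≤ Subgroup.center G)
    (hZ : Nat.card Z = p) (hpZ : ∀ x : G, x ^ p ∈ Z) :
    ∃ B : Subgroup G, Nat.card B = p ^ 3 ∧ ∀ b ∈ B, b ^ p = 1 := by
  have := Fact.mk hp
  have hGp : IsPGroup p G := IsPGroup.of_card hG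
  have hZn : Z.Normal := ⟨fun n hn g => by
    rw [Subgroup.mem_center_iff.mp (hZc hn) g]; simpa using hn⟩
  have cen : ∀ z ∈ Z, ∀ g : G, Commute g z := fun z hz g => Subgroup.mem_center_iff.mp (hZc hz) g
  have hQ : Nat.card (G ⧸ Z) = p ^ 3 := by
    have h := Subgroup.card_eq_card_quotient_mul_card_subgroup Z
    rw [hG, hZ, pow_succ] at h
    exact (Nat.eq_of_mul_eq_mul_right hp.pos h).symm
  have hQp : IsPGroup p (G ⧸ Z) := IsPGroup.of_card hQ
  have hQn : Nontrivial (G ⧸ Z) := by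
    rw [← Finite.one_lt_card_iff_nontrivial, hQ]
    exact Nat.one_lt_pow (by norm_num) hp.one_lt
  have := hQp.center_nontrivial
  obtain ⟨⟨n', hn'⟩, hn1⟩ := exists_ne (1 : Subgroup.center (G ⧸ Z))
  obtain ⟨n, rfl⟩ := QuotientGroup.mk'_surjective Z n'
  have hn1' : QuotientGroup.mk' Z n ≠ 1 := fun h => hn1 (Subtype.ext h)
  set N := (Subgroup.zpowers (QuotientGroup.mk' Z n)).comap (QuotientGroup.mk' Z) with hN
  have hNZ : ∀ m ∈ N, ∀ g : G, ⁅m, g⁆ ∈ Z := by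
    intro m hm g
    have h1 : Subgroup.zpowers (QuotientGroup.mk' Z n) ≤ Subgroup.center _ := by
      rw [Subgroup.zpowers_le]; exact hn'
    rw [← mk_comm_iff]
    exact (Subgroup.mem_center_iff.mp (h1 hm) _).symm
  have hZN : Z ≤ N := by
    intro z hz
    have : QuotientGroup.mk' Z z = 1 := by
      rw [← MonoidHom.mem_ker, QuotientGroup.ker_mk']; exact hz
    rw [hN, Subgroup.mem_comap, this]
    exact one_mem _
  have hNn : N.Normal := ⟨fun m hm g => by
    have : g * m * g⁻¹ = m * ⁅m⁻¹, g⁆ := by simp [commutatorElement_def, mul_assoc]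
    rw [this]
    exact N.mul_mem hm (hZN (hNZ _ (N.inv_mem hm) _))⟩
  have hNeq : N = Z ⊔ Subgroup.zpowers n := by
    rw [hN, ← MonoidHom.map_zpowers, Subgroup.comap_map_eq, QuotientGroup.ker_mk', sup_comm]
  have hnN : n ∈ N := Subgroup.mem_zpowers _
  have hord : Nat.card (Subgroup.zpowers (QuotientGroup.mk' Z n)) = p := by
    rw [Nat.card_zpowers]
    apply orderOf_eq_prime _ hn1'
    rw [← map_pow, ← MonoidHom.mem_ker, QuotientGroup.ker_mk']
    exact hpZ n
  have hNi : Nat.card (G ⧸ N) = p ^ 2 := by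
    have h1 : N.index = (Subgroup.zpowers (QuotientGroup.mk' Z n)).index :=
      Subgroup.index_comap_of_surjective _ (QuotientGroup.mk'_surjective Z)
    have h2 := Subgroup.card_mul_index (Subgroup.zpowers (QuotientGroup.mk' Z n))
    rw [hord, ← h1, hQ, pow_succ, mul_comm] at h2
    exact Nat.eq_of_mul_eq_mul_right hp.pos h2
  have hNc : Nat.card N = p ^ 2 := by
    have h := Subgroup.card_eq_card_quotient_mul_card_subgroup N
    rw [hG, hNi, show p ^ 4 = p ^ 2 * p ^ 2 by ring] at h
    exact (Nat.eq_of_mul_eq_mul_left (pow_pos hp.pos 2) h).symm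
  have hGN : ∀ x y : G, ⁅x, y⁆ ∈ N := by
    intro x y
    rw [← mk_comm_iff]
    exact comm_of_small hp (hGp.to_quotient N) hNi.le _ _
  -- the centralizer of n
  let h : G →* G := MonoidHom.mk' (fun g => ⁅n, g⁆) (by
    intro x y
    have e : ⁅n, x * y⁆ = ⁅n, x⁆ * (x * ⁅n, y⁆ * x⁻¹) := by
      simp [commutatorElement_def, mul_assoc]
    rw [e, (cen _ (hNZ n hnN y) x).eq, mul_inv_cancel_right])
  have hC := ker_card hp hG Z hZ h (fun g => hNZ n hnN g)
  obtain ⟨a, haC, haN⟩ : ∃ a ∈ h.ker, a ∉ N := by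
    by_contra hcon
    push Not at hcon
    have h1 : h.ker ≤ N := hcon
    have h2 := Nat.le_of_dvd Nat.card_pos (Subgroup.card_dvd_of_le h1)
    rw [hNc] at h2
    have := (Nat.pow_le_pow_iff_right hp.one_lt).mp (hC.trans h2)
    omega
  have hna : n * a = a * n := commutatorElement_eq_one_iff_mul_comm.mp haC
  have haN' : QuotientGroup.mk' N a ≠ 1 := by
    intro h
    rw [← MonoidHom.mem_ker, QuotientGroup.ker_mk'] at h
    exact haN h
  obtain ⟨b, hb⟩ := gen_of_small hp (hGp.to_quotient N) hNi.le _ haN'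
  obtain ⟨b, rfl⟩ := QuotientGroup.mk'_surjective N b
  have hgen := lift_gen N a b hb
  set A := N ⊔ Subgroup.zpowers a with hA
  have hNA : N ≤ A := le_sup_left
  have hAn : A.Normal := normal_of_comm A (fun x y => hNA (hGN x y))
  have hAc : ∀ x ∈ A, ∀ y ∈ A, Commute x y := by
    intro x hx y hy
    rw [hA, hNeq] at hx hy
    exact comm_gen' Z hZc n a hna x y hx hy
  have hpw : ∀ b : G, ∀ u ∈ A, (b * u) ^ p = b ^ p * u ^ p := by
    intro b u hu
    have e : ∀ x y : G, ⁅y⁻¹, x⁻¹⁆ = y⁻¹ * (x⁻¹ * y * x) := by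
      intro x y; simp [commutatorElement_def, mul_assoc]
    have e' : ∀ x y : G, y * x = x * (y * ⁅y⁻¹, x⁻¹⁆) := by
      intro x y; rw [e]; group
    have hexp : ∀ u ∈ A, ⁅u⁻¹, b⁻¹⁆ ^ p = 1 := by
      intro u hu
      have h1 : b⁻¹ * u * b ∈ A := by
        have := hAn.conj_mem u hu b⁻¹
        simpa using this
      have h2 : (b⁻¹ * u * b) ^ p = u ^ p := by
        have h3 := conj_pow (i := p) (b := u) (a := b⁻¹)
        rw [inv_inv] at h3
        rw [h3, (cen _ (hpZ u) b⁻¹).eq, inv_mul_cancel_right]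
      rw [e, (hAc _ (A.inv_mem hu) _ h1).mul_pow, h2, inv_pow, inv_mul_cancel]
    have hcN : ⁅u⁻¹, b⁻¹⁆ ∈ N := hGN _ _
    have hdZ : ⁅⁅u⁻¹, b⁻¹⁆⁻¹, b⁻¹⁆ ∈ Z := hNZ _ (N.inv_mem hcN) _
    rw [pow_formula b u _ _ (e' _ _) (e' _ _) (cen _ hdZ _) (hAc _ hu _ (hNA hcN))
      (cen _ hdZ _) (cen _ hdZ _)]
    obtain ⟨k, hk⟩ : p ∣ p.choose 2 := hp.dvd_choose_self (by norm_num) (by omega)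
    obtain ⟨l, hl⟩ : p ∣ p.choose 3 := hp.dvd_choose_self (by norm_num) (by omega)
    rw [hk, hl, pow_mul, pow_mul, hexp u hu, hexp _ (hNA hcN)]
    simp
  have hmul : ∀ x y : G, (x * y) ^ p = x ^ p * y ^ p := by
    have dec : ∀ x : G, ∃ i : ℤ, ∃ u ∈ A, x = b ^ i * u := by
      intro x
      have hx : x ∈ Subgroup.zpowers b ⊔ A := by rw [sup_comm, hgen]; trivial
      rw [Subgroup.mem_sup_of_normal_right] at hx
      obtain ⟨_, ⟨i, rfl⟩, u, hu, rfl⟩ := hx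
      exact ⟨i, u, hu, rfl⟩
    intro x y
    obtain ⟨i, u, hu, rfl⟩ := dec x
    obtain ⟨j, v, hv, rfl⟩ := dec y
    have hu' : (b ^ j)⁻¹ * u * b ^ j ∈ A := by
      have := hAn.conj_mem u hu (b ^ j)⁻¹
      simpa using this
    have h2 : ((b ^ j)⁻¹ * u * b ^ j) ^ p = u ^ p := by
      have h3 := conj_pow (i := p) (b := u) (a := (b ^ j)⁻¹)
      rw [inv_inv] at h3
      rw [h3, (cen _ (hpZ u) _).eq, inv_mul_cancel_right]
    have e : b ^ i * u * (b ^ j * v) = (b ^ i * b ^ j) * (((b ^ j)⁻¹ * u * b ^ j) * v) := by group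
    rw [e, hpw _ _ (A.mul_mem hu' hv), (hAc _ hu' _ hv).mul_pow, h2, hpw _ u hu, hpw _ v hv,
      ((Commute.refl b).zpow_zpow i j).mul_pow]
    simp only [mul_assoc]
    rw [← mul_assoc ((b ^ j) ^ p) (u ^ p), (cen _ (hpZ u) ((b ^ j) ^ p)).eq, mul_assoc]
  let f : G →* G := MonoidHom.mk' (fun x => x ^ p) hmul
  exact ker_big hp hGp f (fun x => rfl) (ker_card hp hG Z hZ f hpZ)

lemma blackburn_step {G : Type*} [Group G] [Finite G] {p : ℕ} (hp : p.Prime) (hG : IsPGroup p G)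
    (Z : Subgroup G) [Z.Normal] (hZc : Z ≤ Subgroup.center G) (hZ : Nat.card Z = p)
    (hZV : ∀ V : Subgroup G, V.Normal → (∀ x ∈ commutator G, x ^ p ∈ V) →
      (∀ x ∈ commutator G, ∀ g : G, ⁅g, x⁆ ∈ V) → Z ≤ V)
    (hm : IsMetacyclic (G ⧸ Z)) : IsMetacyclic G := by
  have := Fact.mk hp
  have cen : ∀ z ∈ Z, ∀ g : G, Commute g z := fun z hz g => Subgroup.mem_center_iff.mp (hZc hz) g
  have zp : ∀ z ∈ Z, z ^ p = 1 := by
    intro z hz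
    have := pow_card_eq_one' (x := (⟨z, hz⟩ : Z))
    rw [hZ] at this
    exact congrArg Subtype.val this
  obtain ⟨M, hMn, hMc, b, hMb⟩ := hm
  obtain ⟨a, rfl⟩ := (Subgroup.isCyclic_iff_exists_zpowers_eq_top M).mp hMc
  obtain ⟨a, rfl⟩ := QuotientGroup.mk'_surjective Z a
  obtain ⟨b, rfl⟩ := QuotientGroup.mk'_surjective Z b
  have hgen := lift_gen Z a b hMb
  have hNeq : (Subgroup.zpowers (QuotientGroup.mk' Z a)).comap (QuotientGroup.mk' Z)
      = Z ⊔ Subgroup.zpowers a := by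
    rw [← MonoidHom.map_zpowers, Subgroup.comap_map_eq, QuotientGroup.ker_mk', sup_comm]
  have hNn : (Z ⊔ Subgroup.zpowers a).Normal := by
    rw [← hNeq]; exact hMn.comap _
  by_cases hZa : Z ≤ Subgroup.zpowers a
  · rw [sup_eq_right.mpr hZa] at hNn hgen
    exact ⟨Subgroup.zpowers a, hNn, inferInstance, b, hgen⟩
  exfalso
  apply hZa
  -- conjugates of a
  have conj : ∀ g : G, ∃ z ∈ Z, ∃ k : ℤ, g * a * g⁻¹ = z * a ^ k := by
    intro g
    have h1 : g * a * g⁻¹ ∈ Z ⊔ Subgroup.zpowers a :=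
      hNn.conj_mem a ((le_sup_right : Subgroup.zpowers a ≤ _) (Subgroup.mem_zpowers a)) g
    rw [Subgroup.mem_sup_of_normal_left] at h1
    obtain ⟨z, hz, _, ⟨k, rfl⟩, h⟩ := h1
    exact ⟨z, hz, k, h.symm⟩
  have hVn : (Subgroup.zpowers (a ^ p)).Normal := by
    constructor
    rintro _ ⟨m, rfl⟩ g
    obtain ⟨z, hz, k, hk⟩ := conj g
    have h1 : g * a ^ p * g⁻¹ = (a ^ p) ^ k := by
      rw [← conj_pow, hk, (cen z hz _).symm.mul_pow, zp z hz, one_mul, ← zpow_natCast,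
        ← zpow_natCast, ← zpow_mul, ← zpow_mul, mul_comm]
    have h2 : g * (a ^ p) ^ m * g⁻¹ = ((a ^ p) ^ k) ^ m := by
      rw [← h1, conj_zpow]
    show g * (a ^ p) ^ m * g⁻¹ ∈ _
    rw [h2, ← zpow_mul]
    exact Subgroup.zpow_mem_zpowers _ _
  set V := Subgroup.zpowers (a ^ p) with hV
  have hWn : (V ⊔ Z).Normal := inferInstance
  have hba : ⁅b, a⁆ ∈ V ⊔ Z := by
    obtain ⟨z, hz, i, hi⟩ := conj b
    have e : ⁅b, a⁆ = z * a ^ (i - 1) := by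
      rw [commutatorElement_def, hi, mul_assoc, zpow_sub_one]
    have hzW : z ∈ V ⊔ Z := (le_sup_right : Z ≤ _) hz
    rw [e]
    refine Subgroup.mul_mem _ hzW ?_
    by_cases ha : QuotientGroup.mk' Z a = 1
    · rw [← MonoidHom.mem_ker, QuotientGroup.ker_mk'] at ha
      exact (le_sup_right : Z ≤ V ⊔ Z) (Z.zpow_mem ha _)
    have hi' : QuotientGroup.mk' Z b * QuotientGroup.mk' Z a * (QuotientGroup.mk' Z b)⁻¹
        = (QuotientGroup.mk' Z a) ^ i := by
      have := congrArg (QuotientGroup.mk' Z) hi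
      have hz1 : QuotientGroup.mk' Z z = 1 := by
        rw [← MonoidHom.mem_ker, QuotientGroup.ker_mk']; exact hz
      rw [map_mul, map_mul, map_mul, hz1, one_mul, map_inv, map_zpow] at this
      exact this
    have hit : ∀ k : ℕ, (QuotientGroup.mk' Z b) ^ k * QuotientGroup.mk' Z a *
        ((QuotientGroup.mk' Z b) ^ k)⁻¹ = (QuotientGroup.mk' Z a) ^ (i ^ k) := by
      intro k
      induction k with
      | zero => simp
      | succ k ih =>
        rw [pow_succ', mul_inv_rev]
        have : ∀ x y w : G ⧸ Z, x * y * w * (y⁻¹ * x⁻¹) = x * (y * w * y⁻¹) * x⁻¹ := by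
          intro x y w; group
        rw [this, ih, ← conj_zpow, hi', ← zpow_mul, pow_succ']
    obtain ⟨m, hm⟩ := IsPGroup.iff_card.mp hG
    have h1 := hit (p ^ m)
    rw [← map_pow, ← hm, pow_card_eq_one', map_one, one_mul, inv_one, mul_one] at h1
    have h2 : (QuotientGroup.mk' Z a) ^ (i ^ Nat.card G - 1) = 1 := by
      rw [zpow_sub_one, ← h1, mul_inv_cancel]
    have h3 := orderOf_dvd_iff_zpow_eq_one.mpr h2
    have hpd : p ∣ orderOf (QuotientGroup.mk' Z a) := by
      obtain ⟨k, hk⟩ := IsPGroup.iff_orderOf.mp (hG.to_quotient Z) (QuotientGroup.mk' Z a)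
      rw [hk]
      apply dvd_pow_self
      rintro rfl
      rw [pow_zero, orderOf_eq_one_iff] at hk
      exact ha hk
    have h4 : (p : ℤ) ∣ i ^ Nat.card G - 1 := (Int.natCast_dvd_natCast.mpr hpd).trans h3
    have h5 : (p : ℤ) ∣ i - 1 := by
      rw [← ZMod.intCast_zmod_eq_zero_iff_dvd] at h4 ⊢
      push_cast at h4 ⊢
      rwa [hm, ZMod.pow_card_pow] at h4
    obtain ⟨k, hk⟩ := h5
    rw [hk, zpow_mul, zpow_natCast]
    exact (le_sup_left : V ≤ V ⊔ Z) (Subgroup.zpow_mem_zpowers _ _)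
  have hgen' : Z ⊔ Subgroup.zpowers b ⊔ Subgroup.zpowers a = ⊤ := by
    rw [← hgen, sup_assoc, sup_assoc, sup_comm (Subgroup.zpowers a)]
  have hcomm : commutator G ≤ V ⊔ Z := by
    rw [commutator_def, Subgroup.commutator_le]
    intro x _ y _
    refine comm_mem (V ⊔ Z) Z ?_ b a hba hgen' x y
    intro n hn g
    rw [commutatorElement_eq_one_iff_mul_comm.mpr (cen n hn g)]
    exact one_mem _
  refine (hZV V hVn ?_ ?_).trans ?_
  · intro x hx
    have hx := hcomm hx
    rw [Subgroup.mem_sup_of_normal_left] at hx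
    obtain ⟨v, hv, z, hz, rfl⟩ := hx
    rw [(cen z hz v).mul_pow, zp z hz, mul_one]
    exact V.pow_mem hv p
  · intro x hx g
    have hx := hcomm hx
    rw [Subgroup.mem_sup_of_normal_left] at hx
    obtain ⟨v, hv, z, hz, rfl⟩ := hx
    have : ⁅g, v * z⁆ = (g * v * g⁻¹) * v⁻¹ := by
      rw [commutatorElement_def, mul_inv_rev]
      have h1 := (cen z hz g⁻¹).eq
      calc g * (v * z) * g⁻¹ * (z⁻¹ * v⁻¹) = g * v * (z * g⁻¹) * z⁻¹ * v⁻¹ := by group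
        _ = _ := by rw [← h1]; group
    rw [this]
    exact V.mul_mem (hVn.conj_mem v hv g) (V.inv_mem hv)
  · rw [hV, Subgroup.zpowers_le]
    exact Subgroup.npow_mem_zpowers a p

lemma exists_central {G : Type*} [Group G] [Finite G] {p : ℕ} (hp : p.Prime) (hG : IsPGroup p G)
    (K : Subgroup G) [K.Normal] (hK : K ≠ ⊥) :
    ∃ Z : Subgroup G, Z ≤ K ∧ Z ≤ Subgroup.center G ∧ Nat.card Z = p := by
  have := Fact.mk hp
  have hnt : Nontrivial K := (Subgroup.nontrivial_iff_ne_bot K).mpr hK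
  have key := (hG.of_equiv ConjAct.toConjAct).exists_fixed_point_of_prime_dvd_card_of_fixed_point K
  have dvd : p ∣ Nat.card K := by
    obtain ⟨n, hn0, hn⟩ := (hG.to_subgroup K).nontrivial_iff_card.mp inferInstance
    exact hn.symm ▸ dvd_pow_self _ (ne_of_gt hn0)
  obtain ⟨k, hk, hk1⟩ := key dvd (a := 1) (by intro g; simp)
  have hkc : (k : G) ∈ Subgroup.center G := by
    rw [Subgroup.mem_center_iff]
    intro g
    have h1 := congrArg Subtype.val (hk (ConjAct.toConjAct g))
    rw [ConjAct.Subgroup.val_conj_smul, ConjAct.smul_def, ConjAct.ofConjAct_toConjAct] at h1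
    exact mul_inv_eq_iff_eq_mul.mp h1
  set L := K ⊓ Subgroup.center G with hL
  have hLn : L ≠ ⊥ := by
    intro h
    have : (k : G) ∈ L := ⟨k.2, hkc⟩
    rw [h, Subgroup.mem_bot] at this
    exact hk1 (Subtype.ext this.symm)
  have hnt : Nontrivial L := (Subgroup.nontrivial_iff_ne_bot L).mpr hLn
  obtain ⟨n, hn0, hn⟩ := (hG.to_subgroup L).nontrivial_iff_card.mp inferInstance
  obtain ⟨B, hB⟩ := exists_sub hp (hG.to_subgroup L) (n := 1)
    (by rw [hn]; exact Nat.pow_le_pow_right hp.pos hn0)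
  refine ⟨B.map L.subtype, ?_, ?_, ?_⟩
  · exact (Subgroup.map_subtype_le B).trans inf_le_left
  · exact (Subgroup.map_subtype_le B).trans inf_le_right
  · rw [Subgroup.card_map_of_injective L.subtype_injective, hB, pow_one]

theorem main_aux (p : ℕ) (hp : p.Prime) (hp3 : 3 < p) (n : ℕ) :
    ∀ (G : Type*) [Group G] [Finite G], IsPGroup p G → Nat.card G = n →
      IsMetacyclic G ∨ ∃ B : Subgroup G, Nat.card B = p ^ 3 ∧ ∀ b ∈ B, b ^ p = 1 := by
  induction n using Nat.strong_induction_on with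
  | _ n ih =>
  intro G _ _ hG hn
  have := Fact.mk hp
  set S : Set G := {y | ∃ x ∈ commutator G, y = x ^ p ∨ ∃ g : G, y = ⁅g, x⁆} with hS
  by_cases hK : Subgroup.normalClosure S = ⊥
  · have hS1 : ∀ y ∈ S, y = 1 := by
      intro y hy
      have := Subgroup.subset_normalClosure hy
      rw [hK] at this
      exact this
    have hc : ∀ x y : G, ⁅x, y⁆ ∈ commutator G := fun x y =>
      Subgroup.commutator_mem_commutator (Subgroup.mem_top x) (Subgroup.mem_top y)
    apply class_two hp (by omega) hG
    · intro x y
      rw [Subgroup.mem_center_iff]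
      intro g
      exact commutatorElement_eq_one_iff_mul_comm.mp (hS1 _ ⟨_, hc x y, Or.inr ⟨g, rfl⟩⟩)
    · intro x y
      exact hS1 _ ⟨_, hc x y, Or.inl rfl⟩
  obtain ⟨Z, hZK, hZc, hZ⟩ := exists_central hp hG _ hK
  have hZn : Z.Normal := ⟨fun n hn g => by
    rw [Subgroup.mem_center_iff.mp (hZc hn) g]; simpa using hn⟩
  have hcard := Subgroup.card_eq_card_quotient_mul_card_subgroup Z
  rw [hZ] at hcard
  have hlt : Nat.card (G ⧸ Z) < n := by
    rw [← hn, hcard]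
    exact lt_mul_of_one_lt_right Nat.card_pos hp.one_lt
  rcases ih _ hlt (G ⧸ Z) (hG.to_quotient Z) rfl with hm | ⟨B, hB, hBe⟩
  · left
    refine blackburn_step hp hG Z hZc hZ ?_ hm
    intro V hV h1 h2
    refine hZK.trans (Subgroup.normalClosure_le_normal ?_)
    rintro y ⟨x, hx, rfl | ⟨g, rfl⟩⟩
    · exact h1 x hx
    · exact h2 x hx g
  · right
    set C := B.comap (QuotientGroup.mk' Z) with hC
    have hZC : Z ≤ C := by
      intro z hz
      have : QuotientGroup.mk' Z z = 1 := by
        rw [← MonoidHom.mem_ker, QuotientGroup.ker_mk']; exact hz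
      rw [hC, Subgroup.mem_comap, this]
      exact one_mem _
    have hCcard : Nat.card C = p ^ 4 := by
      have h1 : C.index = B.index :=
        Subgroup.index_comap_of_surjective _ (QuotientGroup.mk'_surjective Z)
      have h2 := Subgroup.card_mul_index C
      have h3 := Subgroup.card_mul_index B
      have h4 : B.index ≠ 0 := Subgroup.index_ne_zero_of_finite
      rw [h1, hcard, ← h3, hB] at h2
      apply Nat.eq_of_mul_eq_mul_right (Nat.pos_of_ne_zero h4)
      rw [h2]; ring
    have hZ' : Nat.card (Z.subgroupOf C) = p := by
      rw [← hZ]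
      exact Nat.card_congr (Subgroup.subgroupOfEquivOfLe hZC).toEquiv
    obtain ⟨D, hD, hDe⟩ := order_four hp hp3 hCcard (Z.subgroupOf C) (by
        intro z hz
        rw [Subgroup.mem_center_iff]
        intro g
        exact Subtype.ext (Subgroup.mem_center_iff.mp (hZc hz) g)) hZ' (by
        intro x
        rw [Subgroup.mem_subgroupOf, Subgroup.coe_pow, ← QuotientGroup.ker_mk' Z,
          MonoidHom.mem_ker, map_pow]
        exact hBe _ x.2)
    refine ⟨D.map C.subtype, ?_, ?_⟩
    · rw [Subgroup.card_map_of_injective C.subtype_injective, hD]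
    · rintro _ ⟨d, hd, rfl⟩
      rw [← map_pow, hDe d hd, map_one]

end QG

/-- A finite non-metacyclic `q`-group, `q > 3` a prime, contains a subgroup of exponent `q`
and order `q^3`. -/
theorem nonmetacyclic_qgroup_has_subgroup_of_exponent_q_order_q_cubed
    (q : ℕ) (hq : q.Prime) (hq3 : 3 < q)
    (A : Type*) [Group A] [Finite A] (hA : IsPGroup q A) (hnm : ¬ IsMetacyclic A) :
    ∃ B : Subgroup A, Nat.card B = q ^ 3 ∧ ∀ b ∈ B, b ^ q = 1 :=
  (QG.main_aux q hq hq3 _ A hA rfl).resolve_left hnm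
end

section
/- For all positive integers p (a prime), c, d and h there exists a number N = N(c,d,p,h) with the following property: let FH be a supersolvable Frobenius group with kernel F an elementary abelian p-group of order p^2 and complement H of order h, let R be a commutative ring with unity whose additive group is finite and in which p is invertible, and let L be a Lie algebra over R on which FH acts by Lie algebra automorphisms. If the fixed-point subalgebra C_L(H) is nilpotent of class at most c and C_L(x) is nilpotent of class at most d for every nontrivial x ∈ F, then L is nilpotent of nilpotency class at most N. -/
/-- A group is supersolvable if it has a normal series with cyclic factors all of whose terms
are normal in the whole group.  (Using normality of `s i`, cyclicity of the factor
`s (i+1) ⧸ s i` is expressed by `s (i+1) = s i ⊔ ⟨g⟩` for a single element `g`.) -/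
def IsSupersolvable (G : Type*) [Group G] : Prop :=
  ∃ (n : ℕ) (s : ℕ → Subgroup G), s 0 = ⊥ ∧ s n = ⊤ ∧ (∀ i, (s i).Normal) ∧
    ∀ i < n, ∃ g : G, s (i + 1) = s i ⊔ Subgroup.zpowers g

/-- The fixed-point submodule `C_L(S)` of a set `S` of Lie-algebra automorphisms acting on `L`
via `ρ`.  (It is in fact a Lie subalgebra.) -/
def fixSub {A R L : Type*} [Group A] [CommRing R] [LieRing L] [LieAlgebra R L]
    (ρ : A → (L ≃ₗ⁅R⁆ L)) (S : Set A) : Submodule R L where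
  carrier := {x | ∀ g ∈ S, ρ g x = x}
  add_mem' := by
    intro x y hx hy g hg
    calc (ρ g) (x + y) = (ρ g) x + (ρ g) y := (ρ g).toLieHom.map_add x y
    _ = x + y := by rw [hx g hg, hy g hg]
  zero_mem' := fun g _ => (ρ g).toLieHom.map_zero
  smul_mem' := by
    intro r x hx g hg
    calc (ρ g) (r • x) = r • (ρ g) x := (ρ g).toLieHom.map_smul r x
    _ = r • x := by rw [hx g hg]

/-- The eigenspace of a Lie-algebra automorphism `e` for the eigenvalue `μ`. -/
def eigSp {R L : Type*} [CommRing R] [LieRing L] [LieAlgebra R L]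
    (e : L ≃ₗ⁅R⁆ L) (μ : R) : Submodule R L where
  carrier := {x | e x = μ • x}
  add_mem' := by
    intro x y hx hy
    simp only [Set.mem_setOf_eq] at *
    calc e (x + y) = e x + e y := e.toLieHom.map_add x y
    _ = μ • (x + y) := by rw [hx, hy, smul_add]
  zero_mem' := by
    show e 0 = μ • (0 : L)
    rw [smul_zero]; exact e.toLieHom.map_zero
  smul_mem' := by
    intro r x hx
    simp only [Set.mem_setOf_eq] at *
    calc e (r • x) = r • e x := e.toLieHom.map_smul r x
    _ = μ • r • x := by rw [hx, smul_comm]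

/-- `braSpan R S T` is the `R`-submodule `[S, T]` spanned by all brackets `⁅x, y⁆` with
`x ∈ S`, `y ∈ T`. -/
def braSpan (R : Type*) {L : Type*} [CommRing R] [LieRing L] [LieAlgebra R L]
    (S T : Set L) : Submodule R L :=
  Submodule.span R {z | ∃ x ∈ S, ∃ y ∈ T, ⁅x, y⁆ = z}

/-- `iterBra R S T n` is the left-normed iterated bracket `[S, T, …, T]` with `T` occurring
`n` times (for `n = 0` it is the span of `S`).  In particular a subalgebra with underlying
set `C` is nilpotent of class at most `c` if and only if `iterBra R C C c = ⊥`, and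
`iterBra R Set.univ C c` is the span `[L, C, …, C]`. -/
def iterBra (R : Type*) {L : Type*} [CommRing R] [LieRing L] [LieAlgebra R L]
    (S T : Set L) : ℕ → Submodule R L
  | 0 => Submodule.span R S
  | n + 1 => braSpan R ((iterBra R S T n : Submodule R L) : Set L) T

/-- The conjugate subgroup `H^f = f⁻¹ H f`. -/
def conjSubgroup {A : Type*} [Group A] (f : A) (H : Subgroup A) : Subgroup A :=
  Subgroup.map (MulAut.conj f⁻¹).toMonoidHom H

set_option linter.unusedSectionVars false

open scoped Pointwise

/-- The vector space of rank two over `ZMod p`. -/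
abbrev VV (p : ℕ) := Fin 2 → ZMod p

/-- An action of `V ⋊ H` on a module. -/
structure FHAct (p : ℕ) (H : Type*) [Group H] [DistribMulAction H (VV p)]
    (R M : Type*) [CommRing R] [AddCommGroup M] [Module R M] where
  U : VV p → M →ₗ[R] M
  T : H → M →ₗ[R] M
  U_zero : ∀ m, U 0 m = m
  U_add : ∀ u v m, U (u + v) m = U u (U v m)
  T_one : ∀ m, T 1 m = m
  comm : ∀ h v m, T h (U v m) = U (h • v) (T h m)

namespace FHAct

section chars
variable {p : ℕ} [Fact p.Prime] {R : Type*} [CommRing R] (ε : AddChar (ZMod p) R)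

lemma sum_mul_eq_zero (h0 : ∑ z, ε z = 0) (a : ZMod p) (ha : a ≠ 0) : ∑ z, ε (z * a) = 0 := by
  rw [← h0]
  exact Fintype.sum_equiv (Equiv.mulRight₀ a ha) _ _ (fun x => rfl)

lemma sum_hom_eq_zero (h0 : ∑ z, ε z = 0) (hp : IsUnit (p : R)) (η : VV p →+ ZMod p)
    (hη : η ≠ 0) : ∑ v, ε (η v) = 0 := by
  obtain ⟨v0, hv0⟩ : ∃ v, η v ≠ 0 := by
    by_contra! h
    exact hη (AddMonoidHom.ext h)
  have h1 : ∀ i : ZMod p, ∑ v, ε (η v) = ∑ v, ε (i * η v0) * ε (η v) := by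
    intro i
    rw [← Fintype.sum_equiv (Equiv.addLeft (i • v0)) (fun v => ε (i * η v0) * ε (η v)) (fun v => ε (η v))]
    intro x
    have : η (i • v0) = i * η v0 := by rw [ZMod.map_smul]; rfl
    simp [this, AddChar.map_add_eq_mul]
  have h2 : (p : R) * ∑ v, ε (η v) = 0 := by
    calc (p : R) * ∑ v, ε (η v) = ∑ i : ZMod p, ∑ v, ε (η v) := by simp [ZMod.card]
      _ = ∑ i : ZMod p, ∑ v, ε (i * η v0) * ε (η v) := Finset.sum_congr rfl (fun i _ => h1 i)
      _ = (∑ i : ZMod p, ε (i * η v0)) * ∑ v, ε (η v) := by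
        rw [Finset.sum_mul_sum]
      _ = 0 := by rw [sum_mul_eq_zero ε h0 _ hv0, zero_mul]
  exact (hp.mul_right_eq_zero).1 h2

/-- The character given by the dot product. -/
def dotHom (w : VV p) : VV p →+ ZMod p where
  toFun v := w ⬝ᵥ v
  map_zero' := dotProduct_zero w
  map_add' := dotProduct_add w

/-- kernels of characters are one-dimensional -/
lemma exists_smul_of_ker (χ : VV p →+ ZMod p) (hχ : χ ≠ 0) (x y : VV p) (hx : x ≠ 0)
    (h1 : χ x = 0) (h2 : χ y = 0) : ∃ t : ZMod p, y = t • x := by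
  have key : ∀ v : VV p, χ v = v 0 * χ (Pi.single 0 1) + v 1 * χ (Pi.single 1 1) := by
    intro v
    have : v = v 0 • Pi.single 0 1 + v 1 • Pi.single 1 1 := by
      ext i; fin_cases i <;> simp
    conv_lhs => rw [this]
    rw [map_add, ZMod.map_smul, ZMod.map_smul]; rfl
  set α := χ (Pi.single 0 1)
  set β := χ (Pi.single 1 1)
  have hab : α ≠ 0 ∨ β ≠ 0 := by
    by_contra! h
    apply hχ
    refine AddMonoidHom.ext fun v => ?_
    rw [key, h.1, h.2]; simp
  rw [key] at h1 h2
  have hd : x 0 * y 1 = x 1 * y 0 := by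
    rcases hab with h | h
    · apply mul_right_cancel₀ h
      linear_combination y 1 * h1 - x 1 * h2
    · apply mul_right_cancel₀ h
      linear_combination x 0 * h2 - y 0 * h1
  by_cases hx0 : x 0 = 0
  · have hx1 : x 1 ≠ 0 := by
      intro h; apply hx; ext i; fin_cases i <;> simp [hx0, h]
    refine ⟨y 1 / x 1, ?_⟩
    have : y 0 = 0 := by
      rw [hx0, zero_mul] at hd
      exact (mul_eq_zero.1 hd.symm).resolve_left hx1
    ext i; fin_cases i
    · simp [this, hx0]
    · simp; field_simp
  · refine ⟨y 0 / x 0, ?_⟩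
    ext i; fin_cases i
    · simp; field_simp
    · simp; field_simp; linear_combination hd

lemma exists_ker (χ : VV p →+ ZMod p) : ∃ x : VV p, x ≠ 0 ∧ χ x = 0 := by
  have : ¬ Function.Injective χ := by
    intro h
    have := Fintype.card_le_of_injective _ h
    simp [ZMod.card] at this
    have h2 := (Fact.out : p.Prime).two_le
    nlinarith
  rw [injective_iff_map_eq_zero] at this
  push Not at this
  obtain ⟨a, ha, hb⟩ := this
  exact ⟨a, hb, ha⟩

end chars

section act
variable {p : ℕ} [Fact p.Prime] {H : Type*} [Group H] [DistribMulAction H (VV p)]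
  {R M : Type*} [CommRing R] [AddCommGroup M] [Module R M] (ε : AddChar (ZMod p) R)
  (a : FHAct p H R M)

/-- homogeneous elements of degree `χ` -/
def eig (χ : VV p →+ ZMod p) : Set M := {m | ∀ v, a.U v m = ε (χ v) • m}

/-- The twisted character. -/
def tw (h : H) (χ : VV p →+ ZMod p) : VV p →+ ZMod p :=
  χ.comp (DistribSMul.toAddMonoidHom (VV p) h⁻¹)

@[simp] lemma tw_apply (h : H) (χ : VV p →+ ZMod p) (v : VV p) : tw h χ v = χ (h⁻¹ • v) := rfl

lemma T_eig (h : H) {χ : VV p →+ ZMod p} {m : M} (hm : m ∈ a.eig ε χ) :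
    a.T h m ∈ a.eig ε (tw h χ) := by
  intro v
  have := a.comm h (h⁻¹ • v) m
  rw [smul_inv_smul] at this
  rw [← this, hm, map_smul]; rfl

/-- The trace. -/
def tr [Fintype H] : M →ₗ[R] M := ∑ h, a.T h

/-- The projection of an element onto a homogeneous component. -/
def proj (χ : VV p →+ ZMod p) (m : M) : M := ∑ v, ε (- χ v) • a.U v m

lemma proj_mem (χ : VV p →+ ZMod p) (m : M) : a.proj ε χ m ∈ a.eig ε χ := by
  intro u
  unfold proj
  rw [map_sum, Finset.smul_sum]
  refine Fintype.sum_equiv (Equiv.addLeft u) _ _ (fun v => ?_)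
  rw [map_smul, ← a.U_add, smul_smul, ← AddChar.map_add_eq_mul]
  simp

lemma sum_proj (h0 : ∑ z, ε z = 0) (hp : IsUnit (p : R)) (m : M) :
    ∑ w : VV p, a.proj ε (dotHom w) m = ((p : R) ^ 2) • m := by
  unfold proj
  rw [Finset.sum_comm]
  have : ∀ v : VV p, ∑ w : VV p, ε (-(dotHom w) v) • a.U v m =
      if v = 0 then ((p : R) ^ 2) • m else 0 := by
    intro v
    rw [← Finset.sum_smul]
    split_ifs with hv
    · subst hv
      simp [a.U_zero, ZMod.card]
    · have := sum_hom_eq_zero ε h0 hp (dotHom (-v)) (by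
        intro h
        apply hv
        ext i
        have := DFunLike.congr_fun h (Pi.single i 1)
        fin_cases i <;> simpa [dotHom] using this)
      have e : ∀ w : VV p, -(dotHom w) v = dotHom (-v) w := by
        intro w; simp [dotHom]; ring
      simp only [e, this, zero_smul]
  simp only [this]
  simp

end act
end FHAct

namespace FHAct

section comm

/-- annihilator ideal of an element -/
def annI (S : Type*) {M : Type*} [CommRing S] [AddCommGroup M] [Module S M] (m : M) : Ideal S :=
  (Submodule.span S {m}).annihilator

lemma mem_annI {S M : Type*} [CommRing S] [AddCommGroup M] [Module S M] {m : M} {s : S} :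
    s ∈ annI S m ↔ s • m = 0 := Submodule.mem_annihilator_span_singleton m s

lemma span_pow_le' {S : Type*} [CommRing S] {X : Set S} {n : ℕ} {J : Ideal S}
    (h : ∀ s ∈ X ^ n, s ∈ J) : Ideal.span X ^ n ≤ J := by
  have : Ideal.span X ^ n = Ideal.span (X ^ n) := Submodule.span_pow (R := S) X n
  rw [this, Ideal.span_le]
  exact h

lemma mem_span_pow' {S : Type*} [CommRing S] {X : Set S} {n : ℕ} {s : S}
    (h : s ∈ X ^ n) : s ∈ Ideal.span X ^ n := by
  have : Ideal.span X ^ n = Ideal.span (X ^ n) := Submodule.span_pow (R := S) X n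
  rw [this]
  exact Ideal.subset_span h

lemma mul_le_annI {S M : Type*} [CommRing S] [AddCommGroup M] [Module S M] {m : M}
    {X : Set S} {k : ℕ} {J : Ideal S} (h : ∀ t ∈ X ^ k, J ≤ annI S (t • m)) :
    Ideal.span X ^ k * J ≤ annI S m := by
  rw [Ideal.mul_le]
  intro r hr s hs
  have : Ideal.span X ^ k ≤ annI S (s • m) := by
    apply span_pow_le'
    intro t ht
    have := mem_annI.1 (h t ht hs)
    rw [mem_annI, smul_comm]; exact this
  have := mem_annI.1 (this hr)
  rw [mem_annI, mul_smul]; exact this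

lemma sup_pow_le {S ι : Type*} [CommRing S] (t : Finset ι) (I : ι → Ideal S)
    (n : ℕ) (J : Ideal S) (h : ∀ i ∈ t, I i ^ n ≤ J) : (t.sup I) ^ (n * t.card + 1) ≤ J := by
  classical
  induction t using Finset.induction_on with
  | empty => simp
  | insert a t ha ih =>
    rw [Finset.sup_insert, Finset.card_insert_of_notMem ha]
    have e : n * (t.card + 1) + 1 = n + (n * t.card + 1) := by ring
    rw [e]
    refine Ideal.sup_pow_add_le_pow_sup_pow.trans (sup_le (h a (by simp)) (ih ?_))
    intro i hi
    exact h i (by simp [hi])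

variable {p : ℕ} [Fact p.Prime] {H : Type*} [Group H] [Fintype H] [DistribMulAction H (VV p)]
  {R M B S : Type*} [CommRing R] [AddCommGroup M] [Module R M] [AddCommGroup B] [Module R B]
  [CommRing S] [Algebra R S] [Module S M] [IsScalarTower R S M]

lemma transport (β : B →ₗ[R] S) (g : M →ₗ[R] M) (g' : B →ₗ[R] B)
    (hg : ∀ b m, g (β b • m) = β (g' b) • g m) (X : Set B) (n : ℕ) :
    ∀ s ∈ (β '' X) ^ n, ∃ s' ∈ (β '' (g' '' X)) ^ n, ∀ m, g (s • m) = s' • g m := by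
  induction n with
  | zero =>
    intro s hs
    simp only [pow_zero, Set.mem_one] at hs
    subst hs
    exact ⟨1, by simp, fun m => by simp⟩
  | succ n ih =>
    intro s hs
    rw [pow_succ, Set.mem_mul] at hs
    obtain ⟨t, ht, u, ⟨b, hb, rfl⟩, rfl⟩ := hs
    obtain ⟨t', ht', h⟩ := ih t ht
    refine ⟨t' * β (g' b), ?_, ?_⟩
    · rw [pow_succ]
      exact Set.mul_mem_mul ht' ⟨g' b, ⟨b, hb, rfl⟩, rfl⟩
    · intro m
      rw [mul_smul, h, hg, mul_smul]

lemma transport' (β : B →ₗ[R] S) (g : M →ₗ[R] M) (g' : B →ₗ[R] B)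
    (hg : ∀ b m, g (β b • m) = β (g' b) • g m) (X : Set B) (n : ℕ) :
    ∀ s' ∈ (β '' (g' '' X)) ^ n, ∃ s ∈ (β '' X) ^ n, ∀ m, g (s • m) = s' • g m := by
  induction n with
  | zero =>
    intro s hs
    simp only [pow_zero, Set.mem_one] at hs
    subst hs
    exact ⟨1, by simp, fun m => by simp⟩
  | succ n ih =>
    intro s hs
    rw [pow_succ, Set.mem_mul] at hs
    obtain ⟨t, ht, u, ⟨_, ⟨b, hb, rfl⟩, rfl⟩, rfl⟩ := hs
    obtain ⟨t', ht', h⟩ := ih t ht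
    refine ⟨t' * β b, ?_, ?_⟩
    · rw [pow_succ]
      exact Set.mul_mem_mul ht' ⟨b, hb, rfl⟩
    · intro m
      rw [mul_smul, h, hg, mul_smul]

/-- Hypotheses of the commutative theorem. -/
structure CommHyp (ε : AddChar (ZMod p) R) (aM : FHAct p H R M) (aB : FHAct p H R B)
    (β : B →ₗ[R] S) (c d : ℕ) : Prop where
  h0 : ∑ z, ε z = 0
  hp : IsUnit (p : R)
  frob : ∀ h : H, h ≠ 1 → ∀ v : VV p, h • v = v → v = 0
  hU : ∀ v b m, aM.U v (β b • m) = β (aB.U v b) • aM.U v m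
  hT : ∀ v b m, aM.T v (β b • m) = β (aB.T v b) • aM.T v m
  h1 : ∀ m, ∀ s ∈ (β '' Set.range aB.tr) ^ c, s • aM.tr m = 0
  h2 : ∀ v ≠ 0, ∀ m, aM.U v m = m → ∀ s ∈ (β '' {b | aB.U v b = b}) ^ d, s • m = 0

variable {ε : AddChar (ZMod p) R} {aM : FHAct p H R M} {aB : FHAct p H R B}
    {β : B →ₗ[R] S} {c d : ℕ}

namespace CommHyp

lemma smul_p (hy : CommHyp ε aM aB β c d) (n : ℕ) {m : M} (h : ((p : R) ^ n) • m = 0) : m = 0 := by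
  have hu : IsUnit ((p : R) ^ n) := hy.hp.pow n
  exact (hu.smul_eq_zero).1 h

lemma all_of_hom (hy : CommHyp ε aM aB β c d) {J : Ideal S}
    (h : ∀ ψ, ∀ m ∈ aM.eig ε ψ, J ≤ annI S m) (m : M) : J ≤ annI S m := by
  intro s hs
  rw [mem_annI]
  apply hy.smul_p 2
  rw [smul_comm, ← aM.sum_proj ε hy.h0 hy.hp, Finset.smul_sum]
  refine Finset.sum_eq_zero fun w _ => ?_
  exact mem_annI.1 (h _ _ (aM.proj_mem ε _ _) hs)

lemma eig_mul (hy : CommHyp ε aM aB β c d) {χ ψ : VV p →+ ZMod p} (n : ℕ) : ∀ s ∈ (β '' aB.eig ε χ) ^ n,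
    ∀ m ∈ aM.eig ε ψ, s • m ∈ aM.eig ε (ψ + n • χ) := by
  induction n with
  | zero =>
    intro s hs m hm
    simp only [pow_zero, Set.mem_one] at hs
    subst hs
    simpa using hm
  | succ n ih =>
    intro s hs m hm
    rw [pow_succ', Set.mem_mul] at hs
    obtain ⟨_, ⟨b, hb, rfl⟩, t, ht, rfl⟩ := hs
    intro v
    rw [mul_smul, hy.hU, ih t ht m hm v, hb v, map_smul, smul_assoc, smul_comm (β b), smul_smul,
      ← AddChar.map_add_eq_mul]
    congr 2
    simp [add_mul]; ring

lemma stepP (hy : CommHyp ε aM aB β c d) {x : VV p} (hx : x ≠ 0) {χ χ' : VV p →+ ZMod p}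
    (h : χ x = 0) (h' : χ' x ≠ 0) (m : M) :
    Ideal.span (β '' aB.eig ε χ') ^ p * Ideal.span (β '' aB.eig ε χ) ^ d ≤ annI S m := by
  revert m
  apply hy.all_of_hom
  intro ψ m hm
  set k := (-ψ x / χ' x).val
  have hk : k ≤ p := (ZMod.val_lt _).le
  refine le_trans (Ideal.mul_mono_left (Ideal.pow_le_pow_right hk)) ?_
  apply mul_le_annI
  intro t ht
  apply span_pow_le'
  intro s hs
  rw [mem_annI]
  apply hy.h2 x hx
  · rw [hy.eig_mul k t ht m hm x]
    have : (ψ + k • χ') x = 0 := by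
      simp [k]
      field_simp; ring
    rw [this]; simp
  · refine Set.pow_subset_pow_left (Set.image_mono ?_) hs
    intro b hb
    have := hb x
    rw [h] at this
    simpa using this

lemma stepQ (hy : CommHyp ε aM aB β c d) (k : H) {y : VV p} (hy0 : y ≠ 0) {χ χ' : VV p →+ ZMod p}
    (h : χ (k⁻¹ • y) = 0) (h' : χ' y ≠ 0) (m : M) {s : S} (hs : s ∈ (β '' aB.eig ε χ) ^ d) :
    Ideal.span (β '' aB.eig ε χ') ^ p ≤ annI S (aM.T k (s • m)) := by
  obtain ⟨s', hs', e⟩ := transport β (aM.T k) (aB.T k) (hy.hT k) _ _ s hs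
  intro r hr
  rw [mem_annI, e, ← mul_smul, ← mem_annI]
  apply hy.stepP hy0 (χ := tw k χ) (χ' := χ') h h'
  apply Ideal.mul_mem_mul hr
  apply mem_span_pow'
  refine Set.pow_subset_pow_left (Set.image_mono ?_) hs'
  rintro _ ⟨b, hb, rfl⟩
  exact aB.T_eig ε k hb

/-- commuting with `U x` -/
lemma fix_pow (hy : CommHyp ε aM aB β c d) (x : VV p) (X : Set B) (hX : ∀ b ∈ X, aB.U x b = b) (n : ℕ) :
    ∀ s ∈ (β '' X) ^ n, ∀ m, aM.U x (s • m) = s • aM.U x m := by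
  induction n with
  | zero =>
    intro s hs m
    simp only [pow_zero, Set.mem_one] at hs
    subst hs; simp
  | succ n ih =>
    intro s hs m
    rw [pow_succ, Set.mem_mul] at hs
    obtain ⟨t, ht, u, ⟨b, hb, rfl⟩, rfl⟩ := hs
    rw [mul_smul, ih t ht, hy.hU, hX b hb, mul_smul]

lemma commutes_zmul (x : VV p) (s : S) (h : ∀ m, aM.U x (s • m) = s • aM.U x m) (i : ℕ) (m : M) :
    aM.U (i • x) (s • m) = s • aM.U (i • x) m := by
  induction i with
  | zero => simp [aM.U_zero]
  | succ n ih => rw [succ_nsmul', aM.U_add, ih, h, aM.U_add]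

lemma tr_apply (aM : FHAct p H R M) (m : M) : aM.tr m = ∑ h, aM.T h m := by
  simp [tr]

lemma U_tr (aM : FHAct p H R M) {χ : VV p →+ ZMod p} {m : M} (hm : m ∈ aM.eig ε χ) (f : VV p) :
    aM.U f (aM.tr m) = ∑ h : H, ε (χ (h⁻¹ • f)) • aM.T h m := by
  rw [tr_apply, map_sum]
  refine Finset.sum_congr rfl fun h _ => ?_
  rw [aM.T_eig ε h hm f]; rfl

/-- partial trace -/
noncomputable def ptr (ε : AddChar (ZMod p) R) (aB : FHAct p H R B) (χ : VV p →+ ZMod p) (K : Finset H)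
    (f : VV p) (b : B) : B := ∑ k ∈ K, ε (χ (k⁻¹ • f)) • aB.T k b

open Classical in
lemma step_main (hy : CommHyp ε aM aB β c d) {χ ψ : VV p →+ ZMod p} (hχ : χ ≠ 0) {x : VV p}
    (hx : x ≠ 0) (hχx : χ x = 0) {m : M} {s0 : S} (hs0 : s0 ∈ (β '' aB.eig ε χ) ^ d)
    (hv : s0 • m ∈ aM.eig ε ψ) (hψ : ψ x ≠ 0) {w : S} (hw : w ∈ (β '' aB.eig ε χ) ^ p)
    (K : Finset H) (hK : K = Finset.univ.filter (fun h : H => χ (h⁻¹ • x) = 0)) (f : VV p) :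
    Ideal.span (β '' (ptr ε aB χ K f '' aB.eig ε χ)) ^ (c + (p * Fintype.card H + 1)) ≤
      annI S (w • (s0 • m)) := by
  set v := s0 • m with hvdef
  have hmemK : ∀ h : H, h ∈ K ↔ χ (h⁻¹ • x) = 0 := by intro h; simp [hK]
  -- elements of K act on x by scalars
  have hKx : ∀ h : H, h ∈ K → ∃ t : ZMod p, h⁻¹ • x = t • x := fun h hh =>
    exists_smul_of_ker χ hχ x _ hx hχx ((hmemK h).1 hh)
  have hnK : ∀ h : H, h ∉ K → χ (h • x) ≠ 0 := by
    intro h hh h3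
    obtain ⟨t, ht⟩ := exists_smul_of_ker χ hχ x _ hx hχx h3
    apply hh
    rw [hmemK]
    have e : x = t • (h⁻¹ • x) := by
      have := congrArg (fun y => h⁻¹ • y) ht
      simp only [inv_smul_smul] at this
      exact this.trans (ZMod.map_smul (DistribSMul.toAddMonoidHom (VV p) h⁻¹) t x)
    have h4 : t * χ (h⁻¹ • x) = 0 := by
      rw [e, ZMod.map_smul] at hχx
      exact hχx
    rcases mul_eq_zero.1 h4 with h5 | h5
    · rw [h5, zero_smul] at e
      exact absurd e hx
    · exact h5
  set v' : M := ∑ k ∈ K, ε (ψ (k⁻¹ • f)) • aM.T k v with hv'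
  set 𝔱 : Ideal S := Ideal.span (β '' (aB.U f '' (aB.tr '' aB.eig ε χ))) with h𝔱
  set 𝔫 : Ideal S := Kᶜ.sup (fun h => Ideal.span (β '' aB.eig ε (tw h χ))) with h𝔫
  have ha : 𝔱 ^ c ≤ annI S (aM.U f (aM.tr v)) := by
    apply span_pow_le'
    intro s' hs'
    obtain ⟨s, hs, e⟩ := transport' β (aM.U f) (aB.U f) (hy.hU f) _ _ s' hs'
    rw [mem_annI, ← e, hy.h1 v s, map_zero]
    exact Set.pow_subset_pow_left (Set.image_mono (Set.image_subset_range _ _)) hs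
  have hb : ∀ h : H, h ∉ K → w • aM.T h v = 0 := by
    intro h hh
    rw [← mem_annI]
    have hhx : h • x ≠ 0 := fun h9 => hx ((smul_eq_zero_iff_eq h).1 h9)
    exact hy.stepQ h (y := h • x) hhx (χ := χ) (χ' := χ) (by simpa using hχx) (hnK h hh) m hs0
      (mem_span_pow' hw)
  have hc : 𝔱 ^ c ≤ annI S (w • v') := by
    intro s hs
    have h1 := mem_annI.1 (ha hs)
    rw [U_tr aM hv f, ← Finset.sum_add_sum_compl K] at h1
    rw [mem_annI, smul_comm]
    have h2 := congrArg (fun y => w • y) h1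
    simp only [smul_add, smul_zero] at h2
    have h3 : w • s • ∑ h ∈ Kᶜ, ε (ψ (h⁻¹ • f)) • aM.T h v = 0 := by
      rw [Finset.smul_sum, Finset.smul_sum]
      refine Finset.sum_eq_zero fun h hh => ?_
      rw [smul_comm w s, smul_comm w, hb h (by simpa using hh), smul_zero, smul_zero]
    rw [h3, add_zero] at h2
    exact h2
  have hd : 𝔫 ^ (p * Fintype.card H + 1) ≤ annI S (w • v') := by
    have h1 : 𝔫 ^ (p * Kᶜ.card + 1) ≤ annI S (w • v') := by
      apply sup_pow_le
      intro h hh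
      rw [Finset.mem_compl, hmemK] at hh
      intro r hr
      rw [mem_annI, smul_comm]
      have : r • v' = 0 := by
        rw [hv', Finset.smul_sum]
        refine Finset.sum_eq_zero fun k hk => ?_
        have := mem_annI.1 (hy.stepQ k hx (χ := χ) (χ' := tw h χ) ((hmemK k).1 hk) hh m hs0 hr)
        rw [smul_comm, this, smul_zero]
      rw [this, smul_zero]
    refine le_trans (Ideal.pow_le_pow_right ?_) h1
    have : Kᶜ.card ≤ Fintype.card H := Finset.card_le_univ _
    gcongr
  have he : Ideal.span (β '' (ptr ε aB χ K f '' aB.eig ε χ)) ≤ 𝔱 ⊔ 𝔫 := by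
    rw [Ideal.span_le]
    rintro _ ⟨_, ⟨b, hb, rfl⟩, rfl⟩
    have h1 : β (ptr ε aB χ K f b) = β (aB.U f (aB.tr b)) -
        ∑ h ∈ Kᶜ, ε (χ (h⁻¹ • f)) • β (aB.T h b) := by
      rw [U_tr aB hb f, ← Finset.sum_add_sum_compl K, map_add, eq_sub_iff_add_eq, ptr]
      congr 1
      simp
    rw [SetLike.mem_coe, h1]
    apply Ideal.sub_mem
    · exact Ideal.mem_sup_left (Ideal.subset_span ⟨_, ⟨_, ⟨b, hb, rfl⟩, rfl⟩, rfl⟩)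
    · apply Ideal.mem_sup_right
      apply Ideal.sum_mem
      intro h hh
      have : β (aB.T h b) ∈ 𝔫 := by
        have h5 : Ideal.span (β '' aB.eig ε (tw h χ)) ≤ 𝔫 := Finset.le_sup (f := fun h => Ideal.span (β '' aB.eig ε (tw h χ))) hh
        exact h5 (Ideal.subset_span ⟨_, aB.T_eig ε h hb, rfl⟩)
      rw [Algebra.smul_def]
      exact Ideal.mul_mem_left _ _ this
  have hf : Ideal.span (β '' (ptr ε aB χ K f '' aB.eig ε χ)) ^ (c + (p * Fintype.card H + 1)) ≤
      annI S (w • v') :=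
    (Ideal.pow_right_mono he _).trans (Ideal.sup_pow_add_le_pow_sup_pow.trans (sup_le hc hd))
  -- projection
  apply span_pow_le'
  intro s hs
  have h1 := mem_annI.1 (hf (mem_span_pow' hs))
  rw [mem_annI]
  rw [← mul_smul] at h1 ⊢
  have hcomm : ∀ m, aM.U x ((s * w) • m) = (s * w) • aM.U x m := by
    intro m
    rw [mul_smul, mul_smul, hy.fix_pow x _ _ _ s hs, hy.fix_pow x _ _ _ w hw]
    · intro b hb
      rw [hb x, hχx]; simp
    · rintro _ ⟨b, hb, rfl⟩
      rw [ptr, map_sum]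
      refine Finset.sum_congr rfl fun k hk => ?_
      rw [map_smul, aB.T_eig ε k hb x, tw_apply, (hmemK k).1 hk]
      simp
  have hcomm' : ∀ (i : ZMod p) m, aM.U (i • x) ((s * w) • m) = (s * w) • aM.U (i • x) m := by
    intro i m
    have : i • x = i.val • x := by
      rw [← Nat.cast_smul_eq_nsmul (ZMod p)]; simp
    rw [this]
    exact commutes_zmul x _ hcomm _ _
  have h2 : ∑ i : ZMod p, ε (-(i * ψ x)) • aM.U (i • x) ((s * w) • v') = 0 := by
    rw [h1]; simp
  have h3 : ∑ i : ZMod p, ε (-(i * ψ x)) • aM.U (i • x) v' = (p : R) • ε (ψ f) • v := by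
    have : ∀ i : ZMod p, ε (-(i * ψ x)) • aM.U (i • x) v' =
        ∑ k ∈ K, ε (i * (ψ (k⁻¹ • x) - ψ x)) • ε (ψ (k⁻¹ • f)) • aM.T k v := by
      intro i
      rw [hv', map_sum, Finset.smul_sum]
      refine Finset.sum_congr rfl fun k hk => ?_
      have e1 : i * (ψ (k⁻¹ • x) - ψ x) = -(i * ψ x) + i * ψ (k⁻¹ • x) := by ring
      rw [map_smul, aM.T_eig ε k hv (i • x), ZMod.map_smul, e1, AddChar.map_add_eq_mul, tw_apply,
        smul_eq_mul, smul_smul, smul_smul, smul_smul]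
      congr 1
      ring
    simp only [this]
    rw [Finset.sum_comm, Finset.sum_eq_single 1]
    · simp [aM.T_one, ZMod.card, Nat.cast_smul_eq_nsmul]
    · intro k hk hk1
      rw [← Finset.sum_smul, sum_mul_eq_zero ε hy.h0, zero_smul]
      intro h5
      obtain ⟨t, ht⟩ := hKx k hk
      rw [ht, ZMod.map_smul, smul_eq_mul, sub_eq_zero] at h5
      have ht1 : t = 1 := by
        apply mul_right_cancel₀ hψ
        rw [h5, one_mul]
      rw [ht1, one_smul] at ht
      exact hx (hy.frob k⁻¹ (by simpa using hk1) x ht)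
    · intro h
      exact absurd ((hmemK 1).2 (by simpa using hχx)) h
  have h4 : (s * w) • (p : R) • ε (ψ f) • v = 0 := by
    rw [← h3, Finset.smul_sum, ← h2]
    refine Finset.sum_congr rfl fun i _ => ?_
    rw [hcomm', smul_comm]
  rw [smul_comm] at h4
  have h5 := hy.smul_p 1 (by simpa using h4)
  have h6 : ε (-(ψ f)) • ((s * w) • ε (ψ f) • v) = 0 := by rw [h5, smul_zero]
  rw [smul_comm, smul_smul, ← AddChar.map_add_eq_mul] at h6
  simpa using h6

open Classical in
lemma mem_sup_ptr (hy : CommHyp ε aM aB β c d) {χ : VV p →+ ZMod p} (hχ : χ ≠ 0)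
    (K : Finset H) (h1K : (1 : H) ∈ K) :
    Ideal.span (β '' aB.eig ε χ) ≤ (Finset.univ : Finset (VV p)).sup
      (fun f => Ideal.span (β '' (ptr ε aB χ K f '' aB.eig ε χ))) := by
  rw [Ideal.span_le]
  rintro _ ⟨b, hb, rfl⟩
  set J := (Finset.univ : Finset (VV p)).sup
      (fun f => Ideal.span (β '' (ptr ε aB χ K f '' aB.eig ε χ))) with hJ
  have key : ∑ f : VV p, ε (-(χ f)) • ptr ε aB χ K f b = ((p : R) ^ 2) • b := by
    have : ∀ f, ε (-(χ f)) • ptr ε aB χ K f b = ∑ k ∈ K, ε ((tw k χ - χ) f) • aB.T k b := by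
      intro f
      rw [ptr, Finset.smul_sum]
      refine Finset.sum_congr rfl fun k hk => ?_
      rw [smul_smul, ← AddChar.map_add_eq_mul]
      congr 2
      simp; ring
    simp only [this]
    rw [Finset.sum_comm, Finset.sum_eq_single 1]
    · have : tw (1 : H) χ - χ = 0 := by ext v; simp
      rw [this]
      simp only [AddMonoidHom.zero_apply, AddChar.map_zero_eq_one, one_smul, aB.T_one,
        Finset.sum_const, Finset.card_univ, Fintype.card_pi, ZMod.card, Finset.prod_const,
        Fintype.card_fin]
      rw [← Nat.cast_smul_eq_nsmul R]; push_cast; rfl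
    · intro k hk hk1
      rw [← Finset.sum_smul, sum_hom_eq_zero ε hy.h0 hy.hp, zero_smul]
      intro h5
      apply hχ
      have hinj : Function.Injective (fun v : VV p => k⁻¹ • v - v) := by
        intro v w hvw
        have : k⁻¹ • (v - w) = v - w := by
          rw [smul_sub]
          simp only at hvw
          linear_combination (exp := 1) hvw
        exact sub_eq_zero.1 (hy.frob k⁻¹ (by simpa using hk1) _ this)
      have hsurj := Finite.surjective_of_injective hinj
      refine AddMonoidHom.ext fun v => ?_
      obtain ⟨u, hu⟩ := hsurj v
      have := DFunLike.congr_fun h5 u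
      rw [← hu]
      simpa using this
    · intro h
      exact absurd h1K h
  have hmem : ((p : R) ^ 2) • β b ∈ J := by
    rw [← map_smul, ← key, map_sum]
    apply Ideal.sum_mem
    intro f _
    rw [map_smul, Algebra.smul_def]
    apply Ideal.mul_mem_left
    have h5 : Ideal.span (β '' (ptr ε aB χ K f '' aB.eig ε χ)) ≤ J :=
      Finset.le_sup (f := fun f => Ideal.span (β '' (ptr ε aB χ K f '' aB.eig ε χ))) (Finset.mem_univ f)
    exact h5 (Ideal.subset_span ⟨_, ⟨b, hb, rfl⟩, rfl⟩)
  obtain ⟨u, hu⟩ := hy.hp.pow 2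
  have : β b = algebraMap R S (↑u⁻¹) * (((p : R) ^ 2) • β b) := by
    rw [← hu, Algebra.smul_def, ← mul_assoc, ← map_mul]; simp
  rw [SetLike.mem_coe, this]
  exact Ideal.mul_mem_left _ _ hmem

/-- the exponent for one homogeneous component -/
def n1 (p c d h : ℕ) : ℕ := ((c + (p * h + 1)) * p ^ 2 + 1) + p + d + d

lemma one_comp (hy : CommHyp ε aM aB β c d) (χ : VV p →+ ZMod p) (m : M) :
    Ideal.span (β '' aB.eig ε χ) ^ (n1 p c d (Fintype.card H)) ≤ annI S m := by
  classical
  revert m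
  apply hy.all_of_hom
  intro ψ m hm
  have hfix : ∀ (x : VV p), χ x = 0 → aB.eig ε χ ⊆ {b | aB.U x b = b} := by
    intro x hx b hb
    have := hb x
    rw [hx] at this
    simpa using this
  by_cases hχ : χ = 0
  · obtain ⟨x, hx, hψx⟩ := exists_ker ψ
    refine le_trans (Ideal.pow_le_pow_right (m := d) (by unfold n1; omega)) ?_
    apply span_pow_le'
    intro s hs
    rw [mem_annI]
    refine hy.h2 x hx m (by rw [hm x, hψx]; simp) s ?_
    exact Set.pow_subset_pow_left (Set.image_mono (hfix x (by simp [hχ]))) hs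
  · obtain ⟨x, hx, hχx⟩ := exists_ker χ
    unfold n1
    rw [pow_add, mul_comm]
    apply mul_le_annI
    intro s0 hs0
    have hv := hy.eig_mul d s0 hs0 m hm
    by_cases hψ : (ψ + d • χ) x = 0
    · refine le_trans (Ideal.pow_le_pow_right (m := d) (by omega)) ?_
      apply span_pow_le'
      intro s hs
      rw [mem_annI]
      refine hy.h2 x hx _ (by rw [hv x, hψ]; simp) s ?_
      exact Set.pow_subset_pow_left (Set.image_mono (hfix x hχx)) hs
    · refine le_trans (Ideal.pow_le_pow_right (Nat.le_add_right _ d)) ?_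
      rw [pow_add, mul_comm]
      apply mul_le_annI
      intro w hw
      set K := Finset.univ.filter (fun h : H => χ (h⁻¹ • x) = 0) with hK
      refine le_trans (Ideal.pow_right_mono (hy.mem_sup_ptr hχ K (by simpa [hK] using hχx)) _) ?_
      have := sup_pow_le (Finset.univ : Finset (VV p))
        (fun f => Ideal.span (β '' (ptr ε aB χ K f '' aB.eig ε χ))) _ (annI S (w • s0 • m))
        (fun f _ => hy.step_main hχ hx hχx hs0 hv hψ hw K hK f)
      have hcard : (Finset.univ : Finset (VV p)).card = p ^ 2 := by simp [ZMod.card]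
      rwa [hcard] at this

theorem main (hy : CommHyp ε aM aB β c d) (m : M) :
    Ideal.span (Set.range β) ^ (n1 p c d (Fintype.card H) * p ^ 2 + 1) ≤ annI S m := by
  classical
  have h1 : Ideal.span (Set.range β) ≤ (Finset.univ : Finset (VV p)).sup
      (fun w => Ideal.span (β '' aB.eig ε (dotHom w))) := by
    rw [Ideal.span_le]
    rintro _ ⟨b, rfl⟩
    set J := (Finset.univ : Finset (VV p)).sup
      (fun w => Ideal.span (β '' aB.eig ε (dotHom w)))
    have hmem : ((p : R) ^ 2) • β b ∈ J := by
      rw [← map_smul, ← aB.sum_proj ε hy.h0 hy.hp, map_sum]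
      apply Ideal.sum_mem
      intro f _
      have h5 : Ideal.span (β '' aB.eig ε (dotHom f)) ≤ J :=
        Finset.le_sup (f := fun w => Ideal.span (β '' aB.eig ε (dotHom w))) (Finset.mem_univ f)
      exact h5 (Ideal.subset_span ⟨_, aB.proj_mem ε _ _, rfl⟩)
    obtain ⟨u, hu⟩ := hy.hp.pow 2
    have : β b = algebraMap R S (↑u⁻¹) * (((p : R) ^ 2) • β b) := by
      rw [← hu, Algebra.smul_def, ← mul_assoc, ← map_mul]; simp
    rw [SetLike.mem_coe, this]
    exact Ideal.mul_mem_left _ _ hmem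
  refine le_trans (Ideal.pow_right_mono h1 _) ?_
  have := sup_pow_le (Finset.univ : Finset (VV p))
        (fun w => Ideal.span (β '' aB.eig ε (dotHom w))) _ (annI S m)
        (fun f _ => hy.one_comp (dotHom f) m)
  have hcard : (Finset.univ : Finset (VV p)).card = p ^ 2 := by simp [ZMod.card]
  rwa [hcard] at this

end CommHyp
end comm
end FHAct

namespace FHAct

section sub
variable {p : ℕ} {H : Type*} [Group H] [DistribMulAction H (VV p)]
  {R M : Type*} [CommRing R] [AddCommGroup M] [Module R M] (a : FHAct p H R M)

/-- invariant submodules -/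
def Inv (Q : Submodule R M) : Prop :=
  (∀ v, ∀ x ∈ Q, a.U v x ∈ Q) ∧ (∀ h, ∀ x ∈ Q, a.T h x ∈ Q)

/-- restriction of an action to an invariant submodule -/
def sub (Q : Submodule R M) (hQ : a.Inv Q) : FHAct p H R Q where
  U v := (a.U v).restrict (hQ.1 v)
  T h := (a.T h).restrict (hQ.2 h)
  U_zero m := Subtype.ext (a.U_zero m)
  U_add u v m := Subtype.ext (a.U_add u v m)
  T_one m := Subtype.ext (a.T_one m)
  comm h v m := Subtype.ext (a.comm h v m)

/-- the action on the quotient by an invariant submodule -/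
def quot (P : Submodule R M) (hP : a.Inv P) : FHAct p H R (M ⧸ P) where
  U v := P.mapQ P (a.U v) (hP.1 v)
  T h := P.mapQ P (a.T h) (hP.2 h)
  U_zero m := by
    obtain ⟨m, rfl⟩ := P.mkQ_surjective m
    simp [a.U_zero]
  U_add u v m := by
    obtain ⟨m, rfl⟩ := P.mkQ_surjective m
    simp [a.U_add]
  T_one m := by
    obtain ⟨m, rfl⟩ := P.mkQ_surjective m
    simp [a.T_one]
  comm h v m := by
    obtain ⟨m, rfl⟩ := P.mkQ_surjective m
    simp [a.comm]

end sub

section lie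
variable {p : ℕ} [Fact p.Prime] {H : Type*} [Group H] [Fintype H] [DistribMulAction H (VV p)]
  {R L : Type*} [CommRing R] [LieRing L] [LieAlgebra R L]

/-- Hypotheses on the Lie algebra. -/
structure LieHyp (ε : AddChar (ZMod p) R) (a : FHAct p H R L) (c d : ℕ) : Prop where
  h0 : ∑ z, ε z = 0
  hp : IsUnit (p : R)
  frob : ∀ h : H, h ≠ 1 → ∀ v : VV p, h • v = v → v = 0
  hU : ∀ v x y, a.U v ⁅x, y⁆ = ⁅a.U v x, a.U v y⁆
  hT : ∀ v x y, a.T v ⁅x, y⁆ = ⁅a.T v x, a.T v y⁆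
  h1 : iterBra R (Set.range a.tr) (Set.range a.tr) c = ⊥
  h2 : ∀ v ≠ 0, iterBra R {x | a.U v x = x} {x | a.U v x = x} d = ⊥

variable {ε : AddChar (ZMod p) R} {a : FHAct p H R L} {c d : ℕ}

/-- multiplication as a bilinear map -/
def brOp (Q B : Submodule R L) (hQB : ∀ m ∈ Q, ∀ b ∈ B, ⁅m, b⁆ ∈ Q) : B →ₗ[R] Q →ₗ[R] Q :=
  LinearMap.mk₂ R (fun b m => ⟨⁅(m : L), (b : L)⁆, hQB m m.2 b b.2⟩)
    (fun b b' m => Subtype.ext (by simp)) (fun r b m => Subtype.ext (by simp))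
    (fun b m m' => Subtype.ext (by simp)) (fun r b m => Subtype.ext (by simp))

/-- multiplication on the section -/
def brQ (Q B P : Submodule R L) (hQB : ∀ m ∈ Q, ∀ b ∈ B, ⁅m, b⁆ ∈ Q)
    (hPB : ∀ m ∈ P, ∀ b ∈ B, ⁅m, b⁆ ∈ P) :
    B →ₗ[R] Module.End R (Q ⧸ P.comap Q.subtype) where
  toFun b := (P.comap Q.subtype).mapQ _ (brOp Q B hQB b) (fun m hm => hPB _ hm b b.2)
  map_add' b b' := by
    refine LinearMap.ext fun m => ?_
    obtain ⟨m, rfl⟩ := Submodule.mkQ_surjective _ m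
    exact congrArg (Submodule.mkQ _) (LinearMap.congr_fun (LinearMap.map_add (brOp Q B hQB) b b') m)
  map_smul' r b := by
    refine LinearMap.ext fun m => ?_
    obtain ⟨m, rfl⟩ := Submodule.mkQ_surjective _ m
    exact congrArg (Submodule.mkQ _) (LinearMap.congr_fun (LinearMap.map_smul (brOp Q B hQB) r b) m)

lemma iterBra_mono {S S' T T' : Set L} (h : S ⊆ S') (h' : T ⊆ T') (n : ℕ) :
    iterBra R S T n ≤ iterBra R S' T' n := by
  induction n with
  | zero => exact Submodule.span_mono h
  | succ n ih =>
    apply Submodule.span_mono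
    rintro _ ⟨x, hx, y, hy, rfl⟩
    exact ⟨x, ih hx, y, h' hy, rfl⟩

lemma mem_iterBra_succ {S T : Set L} {n : ℕ} {x y : L} (hx : x ∈ iterBra R S T n) (hy : y ∈ T) :
    ⁅x, y⁆ ∈ iterBra R S T (n + 1) := Submodule.subset_span ⟨x, hx, y, hy, rfl⟩

lemma tr_sub (a : FHAct p H R L) (Q : Submodule R L) (hQ : a.Inv Q) (m : Q) :
    (((a.sub Q hQ).tr m : Q) : L) = a.tr (m : L) := by
  simp [CommHyp.tr_apply, sub]

lemma tr_quot {M : Type*} [AddCommGroup M] [Module R M] (a : FHAct p H R M) (P : Submodule R M)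
    (hP : a.Inv P) (m : M) :
    (a.quot P hP).tr (P.mkQ m) = P.mkQ (a.tr m) := by
  simp [CommHyp.tr_apply, quot]

/-- the exponent in the ambient commutative theorem -/
def n2 (p c d h : ℕ) : ℕ := CommHyp.n1 p c d h * p ^ 2 + 1

lemma smul_mem_pow {S M : Type*} [CommRing S] [AddCommGroup M] [Module S M] {I : Ideal S} {n : ℕ}
    {s : S} (hs : s ∈ I) {m : M} (hm : m ∈ I ^ n • (⊤ : Submodule S M)) :
    s • m ∈ I ^ (n + 1) • (⊤ : Submodule S M) := by
  rw [pow_succ', Submodule.mul_smul]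
  exact Submodule.smul_mem_smul hs hm

lemma pow_smul_bot {S M : Type*} [CommRing S] [AddCommGroup M] [Module S M] {I : Ideal S} {n : ℕ}
    (hI : ∀ m : M, I ^ n ≤ annI S m) {m : M} (hm : m ∈ I ^ n • (⊤ : Submodule S M)) : m = 0 := by
  have h7 : I ^ n • (⊤ : Submodule S M) = ⊥ := by
    rw [eq_bot_iff, Submodule.smul_le]
    intro r hr m _
    exact mem_annI.1 (hI m hr)
  rw [h7] at hm
  exact hm

lemma tail_comm (Q P B : Submodule R L) (hQB : ∀ m ∈ Q, ∀ b ∈ B, ⁅m, b⁆ ∈ Q)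
    (P' : Submodule R Q) (hP' : ∀ m ∈ P', (m : L) ∈ P)
    {S : Type*} [CommRing S] [Algebra R S] [Module S (Q ⧸ P')]
    [IsScalarTower R S (Q ⧸ P')] (β : B → S)
    (hβ : ∀ (b : B) (m : Q), β b • (P'.mkQ m) = P'.mkQ ⟨⁅(m : L), (b : L)⁆, hQB m m.2 b b.2⟩)
    (n : ℕ) (hI : ∀ m : Q ⧸ P', Ideal.span (Set.range β) ^ n ≤ annI S m) :
    iterBra R (Q : Set L) (B : Set L) n ≤ P := by
  set I := Ideal.span (Set.range β) with hI
  have hW : ∀ n, iterBra R (Q : Set L) (B : Set L) n ≤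
      Submodule.map Q.subtype (Submodule.comap P'.mkQ
        (Submodule.restrictScalars R (I ^ n • (⊤ : Submodule S (Q ⧸ P'))))) := by
    intro n
    induction n with
    | zero =>
      apply Submodule.span_le.2
      intro x hx
      exact ⟨⟨x, hx⟩, by simp, rfl⟩
    | succ n ih =>
      apply Submodule.span_le.2
      rintro _ ⟨x, hx, y, hy', rfl⟩
      obtain ⟨x', hx', rfl⟩ := ih hx
      refine ⟨⟨⁅(x' : L), y⁆, hQB x' x'.2 y hy'⟩, ?_, rfl⟩
      have h5 := hβ ⟨y, hy'⟩ x'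
      have h4 : β ⟨y, hy'⟩ ∈ I := Ideal.subset_span ⟨_, rfl⟩
      have h6 : β ⟨y, hy'⟩ • P'.mkQ x' ∈ I ^ (n + 1) • (⊤ : Submodule S (Q ⧸ P')) :=
        smul_mem_pow h4 hx'
      rw [h5] at h6
      exact h6
  refine (hW _).trans ?_
  rintro _ ⟨x, hx, rfl⟩
  have h8 : P'.mkQ x = 0 := pow_smul_bot (I := I) (n := n) (by assumption) hx
  rw [Submodule.mkQ_apply, Submodule.Quotient.mk_eq_zero] at h8
  exact hP' _ h8

set_option maxHeartbeats 1000000 in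
open scoped IsMulCommutative in
theorem ambient_comm (hy : LieHyp ε a c d) (Q P B : Submodule R L) (hQ : a.Inv Q) (hP : a.Inv P)
    (hB : a.Inv B) (hQB : ∀ m ∈ Q, ∀ b ∈ B, ⁅m, b⁆ ∈ Q) (hPB : ∀ m ∈ P, ∀ b ∈ B, ⁅m, b⁆ ∈ P)
    (hc : ∀ m ∈ Q, ∀ x ∈ B, ∀ y ∈ B, ⁅m, ⁅x, y⁆⁆ ∈ P) :
    iterBra R (Q : Set L) (B : Set L) (n2 p c d (Fintype.card H)) ≤ P := by
  classical
  set P' := P.comap Q.subtype with hP'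
  have hP'inv : (a.sub Q hQ).Inv P' := ⟨fun v x hx => hP.1 v _ hx, fun v x hx => hP.2 v _ hx⟩
  set aM := (a.sub Q hQ).quot P' hP'inv with haM
  set aB := a.sub B hB with haB
  set φ := brQ Q B P hQB hPB with hφ
  have hφmk : ∀ (b : B) (m : Q), φ b (P'.mkQ m) = P'.mkQ ⟨⁅(m : L), (b : L)⁆, hQB m m.2 b b.2⟩ :=
    fun b m => rfl
  have hcom : ∀ x ∈ Set.range φ, ∀ y ∈ Set.range φ, x * y = y * x := by
    rintro _ ⟨x, rfl⟩ _ ⟨y, rfl⟩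
    refine LinearMap.ext fun m => ?_
    obtain ⟨m, rfl⟩ := P'.mkQ_surjective m
    rw [Module.End.mul_apply, Module.End.mul_apply, hφmk, hφmk, hφmk, hφmk, ← sub_eq_zero, ← map_sub,
      Submodule.mkQ_apply, Submodule.Quotient.mk_eq_zero]
    change ⁅⁅(m : L), (y : L)⁆, (x : L)⁆ - ⁅⁅(m : L), (x : L)⁆, (y : L)⁆ ∈ P
    have := hc m m.2 y y.2 x x.2
    have e : ⁅⁅(m : L), (y : L)⁆, (x : L)⁆ - ⁅⁅(m : L), (x : L)⁆, (y : L)⁆ =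
        ⁅(m : L), ⁅(y : L), (x : L)⁆⁆ := by
      rw [leibniz_lie (m : L) (y : L) (x : L), ← lie_skew (⁅(m : L), (x : L)⁆)]
      abel
    rw [e]; exact this
  let S := Algebra.adjoin R (Set.range φ)
  have : IsMulCommutative S := Algebra.isMulCommutative_adjoin R hcom
  let β : B →ₗ[R] S := φ.codRestrict (Subalgebra.toSubmodule S)
    (fun b => Algebra.subset_adjoin ⟨b, rfl⟩)
  have hβ : ∀ (b : B) (m : Q), β b • (P'.mkQ m) = P'.mkQ ⟨⁅(m : L), (b : L)⁆, hQB m m.2 b b.2⟩ :=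
    fun b m => rfl
  have hiter : ∀ (X : Set B) (Y : Set L) (n : ℕ), ∀ s ∈ (β '' X) ^ n, ∀ y : Q, (y : L) ∈ Y →
      ∃ z : Q, (z : L) ∈ iterBra R Y (Subtype.val '' X) n ∧ s • (P'.mkQ y) = P'.mkQ z := by
    intro X Y n
    induction n with
    | zero =>
      intro s hs y hyY
      simp only [pow_zero, Set.mem_one] at hs
      subst hs
      exact ⟨y, Submodule.subset_span hyY, by simp⟩
    | succ n ih =>
      intro s hs y hyY
      rw [pow_succ', Set.mem_mul] at hs
      obtain ⟨_, ⟨b, hb, rfl⟩, t, ht, rfl⟩ := hs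
      obtain ⟨z, hz, e⟩ := ih t ht y hyY
      refine ⟨⟨⁅(z : L), (b : L)⁆, hQB z z.2 b b.2⟩, mem_iterBra_succ hz ⟨b, hb, rfl⟩, ?_⟩
      rw [mul_smul, e, hβ]
  have hC : CommHyp (S := S) ε aM aB β c d :=
    { h0 := hy.h0
      hp := hy.hp
      frob := hy.frob
      hU := by
        intro v b m
        obtain ⟨m, rfl⟩ := P'.mkQ_surjective m
        rw [hβ]
        change P'.mkQ _ = β (aB.U v b) • P'.mkQ ((a.sub Q hQ).U v m)
        rw [hβ]
        congr 1
        exact Subtype.ext (hy.hU v _ _)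
      hT := by
        intro v b m
        obtain ⟨m, rfl⟩ := P'.mkQ_surjective m
        rw [hβ]
        change P'.mkQ _ = β (aB.T v b) • P'.mkQ ((a.sub Q hQ).T v m)
        rw [hβ]
        congr 1
        exact Subtype.ext (hy.hT v _ _)
      h1 := by
        intro m s hs
        obtain ⟨m, rfl⟩ := P'.mkQ_surjective m
        rw [haM, tr_quot]
        obtain ⟨z, hz, e⟩ := hiter _ (Set.range a.tr) c s hs ((a.sub Q hQ).tr m)
          ⟨m, (tr_sub a Q hQ m).symm⟩
        have hz' := iterBra_mono (R := R) (le_refl (Set.range a.tr)) (T' := Set.range a.tr) (by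
          rintro _ ⟨_, ⟨b, rfl⟩, rfl⟩
          exact ⟨b, (tr_sub a B hB b).symm⟩) c hz
        rw [hy.h1, Submodule.mem_bot] at hz'
        rw [e, show z = 0 from Subtype.ext hz', map_zero]
      h2 := by
        intro v hv m hm s hs
        -- replace m by its average
        obtain ⟨m, rfl⟩ := P'.mkQ_surjective m
        have hpv : ∀ i : ℕ, aM.U (i • v) (P'.mkQ m) = P'.mkQ m := by
          intro i
          induction i with
          | zero => simp [aM.U_zero]
          | succ n ih => rw [succ_nsmul', aM.U_add, ih, hm]
        set m' : Q := ∑ i : ZMod p, (a.sub Q hQ).U (i • v) m with hm'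
        have e1 : P'.mkQ m' = (p : R) • P'.mkQ m := by
          rw [hm', map_sum]
          have : ∀ i : ZMod p, P'.mkQ ((a.sub Q hQ).U (i • v) m) = P'.mkQ m := by
            intro i
            have h3 := hpv i.val
            have h4 : i • v = i.val • v := by
              rw [← Nat.cast_smul_eq_nsmul (ZMod p)]; simp
            rw [h4]; exact h3
          simp only [this]
          simp [ZMod.card, Nat.cast_smul_eq_nsmul]
        have e2 : a.U v (m' : L) = m' := by
          have : (a.sub Q hQ).U v m' = m' := by
            rw [hm', map_sum]
            refine Fintype.sum_equiv (Equiv.addLeft 1) _ _ (fun i => ?_)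
            rw [← (a.sub Q hQ).U_add]
            simp [add_smul]
          exact congrArg Subtype.val this
        obtain ⟨z, hz, e⟩ := hiter _ {x | a.U v x = x} d s hs m' e2
        have hz' := iterBra_mono (R := R) (le_refl {x | a.U v x = x}) (T' := {x | a.U v x = x}) (by
          rintro _ ⟨b, hb, rfl⟩
          exact congrArg Subtype.val hb) d hz
        rw [hy.h2 v hv, Submodule.mem_bot] at hz'
        rw [e1, show z = 0 from Subtype.ext hz', map_zero, smul_comm] at e
        exact (hy.hp.smul_eq_zero).1 e }
  exact tail_comm Q P B hQB P' (fun _ h => h) β hβ _ (fun m => hC.main m)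

end lie
end FHAct

namespace FHAct

section solv
variable {R L : Type*} [CommRing R] [LieRing L] [LieAlgebra R L]

/-- the derived series inside the ambient algebra -/
def Dser (B : Submodule R L) : ℕ → Submodule R L
  | 0 => B
  | n + 1 => braSpan R (Dser B n : Set L) (Dser B n : Set L)

/-- closed under bracket -/
def IsSub (B : Submodule R L) : Prop := ∀ x ∈ B, ∀ y ∈ B, ⁅x, y⁆ ∈ B

lemma mem_braSpan {S T : Set L} {x y : L} (hx : x ∈ S) (hy : y ∈ T) : ⁅x, y⁆ ∈ braSpan R S T :=
  Submodule.subset_span ⟨x, hx, y, hy, rfl⟩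

lemma braSpan_le {S T : Set L} {P : Submodule R L} (h : ∀ x ∈ S, ∀ y ∈ T, ⁅x, y⁆ ∈ P) :
    braSpan R S T ≤ P := by
  apply Submodule.span_le.2
  rintro _ ⟨x, hx, y, hy, rfl⟩
  exact h x hx y hy

lemma braSpan_mono {S S' T T' : Set L} (h : S ⊆ S') (h' : T ⊆ T') :
    braSpan R S T ≤ braSpan R S' T' :=
  braSpan_le fun _ hx _ hy => mem_braSpan (h hx) (h' hy)

lemma Dser_add (B : Submodule R L) (m n : ℕ) : Dser B (m + n) = Dser (Dser B m) n := by
  induction n with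
  | zero => rfl
  | succ n ih =>
    rw [← add_assoc]
    simp only [Dser, ih]

lemma Dser_sub {B : Submodule R L} (hB : IsSub B) (n : ℕ) : IsSub (Dser B n) ∧ Dser B n ≤ B := by
  induction n with
  | zero => exact ⟨hB, le_rfl⟩
  | succ n ih =>
    have h1 : Dser B (n + 1) ≤ Dser B n := braSpan_le ih.1
    exact ⟨fun x hx y hy => mem_braSpan (h1 hx) (h1 hy), h1.trans ih.2⟩

lemma Dser_mono {B C : Submodule R L} (h : B ≤ C) (n : ℕ) : Dser B n ≤ Dser C n := by
  induction n with
  | zero => exact h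
  | succ n ih => exact braSpan_mono ih ih

lemma Dser_le_iterBra {B : Submodule R L} (hB : IsSub B) (n : ℕ) :
    Dser B n ≤ iterBra R (B : Set L) (B : Set L) n := by
  induction n with
  | zero => exact Submodule.subset_span
  | succ n ih => exact braSpan_mono ih (Dser_sub hB n).2

lemma iterBra_add (S T : Set L) (m n : ℕ) :
    iterBra R S T (m + n) = iterBra R (iterBra R S T m : Set L) T n := by
  induction n with
  | zero => exact (Submodule.span_eq _).symm
  | succ n ih =>
    rw [← add_assoc]
    simp only [iterBra, ih]

lemma iterBra_ideal {Q B D : Submodule R L} (hQB : ∀ m ∈ Q, ∀ b ∈ B, ⁅m, b⁆ ∈ Q)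
    (hDB : ∀ m ∈ D, ∀ b ∈ B, ⁅m, b⁆ ∈ D) (n : ℕ) :
    ∀ m ∈ iterBra R (Q : Set L) (D : Set L) n, ∀ b ∈ B,
      ⁅m, b⁆ ∈ iterBra R (Q : Set L) (D : Set L) n := by
  induction n with
  | zero =>
    intro m hm b hb
    change _ ∈ Submodule.span R (Q : Set L)
    change m ∈ Submodule.span R (Q : Set L) at hm
    rw [Submodule.span_eq] at *
    exact hQB m hm b hb
  | succ n ih =>
    intro m hm b hb
    change m ∈ Submodule.span R _ at hm
    induction hm using Submodule.span_induction with
    | mem z hz =>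
      obtain ⟨x, hx, y, hy, rfl⟩ := hz
      have e : ⁅⁅x, y⁆, b⁆ = ⁅⁅x, b⁆, y⁆ + ⁅x, ⁅y, b⁆⁆ := by
        rw [leibniz_lie x y b, ← lie_skew (⁅x, b⁆)]
        abel
      rw [e]
      exact add_mem (mem_iterBra_succ (ih x hx b hb) hy) (mem_iterBra_succ hx (hDB y hy b hb))
    | zero => simp
    | add x y _ _ h1 h2 => rw [add_lie]; exact add_mem h1 h2
    | smul r x _ h => rw [smul_lie]; exact Submodule.smul_mem _ _ h

variable {p : ℕ} [Fact p.Prime] {H : Type*} [Group H] [Fintype H] [DistribMulAction H (VV p)]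
variable {ε : AddChar (ZMod p) R} {a : FHAct p H R L} {c d : ℕ}

lemma inv_span {S : Set L} (h1 : ∀ v, ∀ x ∈ S, a.U v x ∈ S) (h2 : ∀ v, ∀ x ∈ S, a.T v x ∈ S) :
    a.Inv (Submodule.span R S) := by
  refine ⟨fun v => ?_, fun v => ?_⟩
  · change Submodule.span R S ≤ (Submodule.span R S).comap (a.U v)
    exact Submodule.span_le.2 fun x hx => Submodule.subset_span (h1 v x hx)
  · change Submodule.span R S ≤ (Submodule.span R S).comap (a.T v)
    exact Submodule.span_le.2 fun x hx => Submodule.subset_span (h2 v x hx)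

lemma inv_braSpan (hy : LieHyp ε a c d) {Q B : Submodule R L} (hQ : a.Inv Q) (hB : a.Inv B) :
    a.Inv (braSpan R (Q : Set L) (B : Set L)) := by
  apply inv_span
  · rintro v _ ⟨x, hx, y, hy', rfl⟩
    exact ⟨_, hQ.1 v x hx, _, hB.1 v y hy', (hy.hU v x y).symm⟩
  · rintro v _ ⟨x, hx, y, hy', rfl⟩
    exact ⟨_, hQ.2 v x hx, _, hB.2 v y hy', (hy.hT v x y).symm⟩

lemma inv_iterBra (hy : LieHyp ε a c d) {Q B : Submodule R L} (hQ : a.Inv Q) (hB : a.Inv B)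
    (n : ℕ) : a.Inv (iterBra R (Q : Set L) (B : Set L) n) := by
  induction n with
  | zero => exact inv_span hQ.1 hQ.2
  | succ n ih => exact inv_braSpan hy ih hB

theorem solv (hy : LieHyp ε a c d) (s : ℕ) : ∀ (Q B : Submodule R L), a.Inv Q → a.Inv B →
    IsSub B → Dser B s = ⊥ → (∀ m ∈ Q, ∀ b ∈ B, ⁅m, b⁆ ∈ Q) →
    iterBra R (Q : Set L) (B : Set L) (n2 p c d (Fintype.card H) ^ s) = ⊥ := by
  induction s with
  | zero =>
    intro Q B hQ hB hs h0 hQB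
    rw [eq_bot_iff, pow_zero]
    apply braSpan_le
    intro x _ y hy'
    rw [show B = ⊥ from h0] at hy'
    rw [show y = 0 from hy', lie_zero]
    exact zero_mem _
  | succ s ih =>
    intro Q B hQ hB hs h0 hQB
    set D := Dser B 1 with hD
    have hDB : D ≤ B := (Dser_sub hs 1).2
    have hDi : a.Inv D := inv_braSpan hy hB hB
    have h1 : ∀ m ∈ D, ∀ b ∈ B, ⁅m, b⁆ ∈ D := fun m hm b hb => mem_braSpan (hDB hm) hb
    have h2 : iterBra R (Q : Set L) (D : Set L) (n2 p c d (Fintype.card H) ^ s) = ⊥ :=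
      ih Q D hQ hDi (Dser_sub hs 1).1 (by rw [hD, ← Dser_add, add_comm]; exact h0)
        (fun m hm b hb => hQB m hm b (hDB hb))
    have h3 : ∀ j, iterBra R (Q : Set L) (B : Set L) (n2 p c d (Fintype.card H) * j) ≤
        iterBra R (Q : Set L) (D : Set L) j := by
      intro j
      induction j with
      | zero => exact le_rfl
      | succ j ihj =>
        rw [mul_add, mul_one, iterBra_add]
        refine (iterBra_mono ihj le_rfl _).trans ?_
        exact ambient_comm hy _ _ B (inv_iterBra hy hQ hDi j) (inv_iterBra hy hQ hDi (j + 1)) hB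
          (iterBra_ideal hQB h1 j) (iterBra_ideal hQB h1 (j + 1))
          (fun m hm x hx y hy' => mem_iterBra_succ hm (mem_braSpan hx hy'))
    rw [eq_bot_iff, pow_succ', ← h2]
    exact h3 _

end solv
end FHAct

namespace FHAct

section kreknin
variable {R L : Type*} [CommRing R] [LieRing L] [LieAlgebra R L] {p : ℕ} [Fact p.Prime]

/-- projections of a grading by `ZMod p` -/
structure Grad (e : ZMod p → L →ₗ[R] L) : Prop where
  sum : ∀ x, ∑ k, e k x = x
  idem : ∀ k x, e k (e k x) = e k x
  bra : ∀ k b x y, e k ⁅x, e b y⁆ = ⁅e (k - b) x, e b y⁆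

/-- generators -/
def genS (e : ZMod p → L →ₗ[R] L) (k : ℕ) (B : Submodule R L) : Set L :=
  {x | x ∈ B ∧ ∃ i : ZMod p, (i = 0 ∨ k ≤ i.val) ∧ e i x = x}

/-- homogeneous components -/
def homC (e : ZMod p → L →ₗ[R] L) (k : ZMod p) (B : Submodule R L) : Set L := {x | x ∈ B ∧ e k x = x}

/-- the subalgebra `E_k(B)` -/
def EE (e : ZMod p → L →ₗ[R] L) (k : ℕ) (B : Submodule R L) : Submodule R L :=
  (LieSubalgebra.lieSpan R L (genS e k B)).toSubmodule

/-- the exponents in the theorem of Kreknin -/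
def tt (m : ℕ) : ℕ → ℕ
  | 0 => 0
  | k + 1 => m * (tt m k + 1) + tt m k

variable {e : ZMod p → L →ₗ[R] L}

lemma EE_lie {k : ℕ} {B : Submodule R L} {x y : L} (hx : x ∈ EE e k B) (hy : y ∈ EE e k B) :
    ⁅x, y⁆ ∈ EE e k B := LieSubalgebra.lie_mem _ hx hy

lemma EE_le {k : ℕ} {B : Submodule R L} {P : Submodule R L} (h1 : IsSub P)
    (h : ∀ x ∈ genS e k B, x ∈ P) : EE e k B ≤ P := by
  let K : LieSubalgebra R L := { P with lie_mem' := fun {x y} hx hy => h1 x hx y hy }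
  have : LieSubalgebra.lieSpan R L (genS e k B) ≤ K := LieSubalgebra.lieSpan_le.2 h
  exact this

lemma gen_mem {k : ℕ} {B : Submodule R L} {x : L} (h : x ∈ genS e k B) : x ∈ EE e k B :=
  LieSubalgebra.subset_lieSpan h

lemma EE_mono {k : ℕ} {B C : Submodule R L} (h : B ≤ C) : EE e k B ≤ EE e k C :=
  EE_le (fun _ hx _ hy => EE_lie hx hy) (fun _ hx => gen_mem ⟨h hx.1, hx.2⟩)

/-- graded submodules -/
def GrS (e : ZMod p → L →ₗ[R] L) (B : Submodule R L) : Prop := ∀ k, ∀ x ∈ B, e k x ∈ B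

lemma GrS_Dser (he : Grad e) {B : Submodule R L} (hB : GrS e B) (n : ℕ) : GrS e (Dser B n) := by
  induction n with
  | zero => exact hB
  | succ n ih =>
    intro k
    change Dser B (n + 1) ≤ (Dser B (n + 1)).comap (e k)
    apply braSpan_le
    intro x hx y hy
    change e k ⁅x, y⁆ ∈ Dser B (n + 1)
    rw [← he.sum y, lie_sum, map_sum]
    refine sum_mem fun b _ => ?_
    rw [he.bra]
    exact mem_braSpan (ih _ x hx) (ih _ y hy)

lemma bra_EE {k : ℕ} {B : Submodule R L} (hs : IsSub B) {v : L} (hv : v ∈ EE e k B) :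
    v ∈ B ∧ ∀ y ∈ B, ⁅y, v⁆ ∈ braSpan R (B : Set L) (genS e k B) := by
  have hvB : EE e k B ≤ B := EE_le hs (fun x hx => hx.1)
  refine ⟨hvB hv, ?_⟩
  let W : Submodule R L :=
    { carrier := {v | v ∈ B ∧ ∀ y ∈ B, ⁅y, v⁆ ∈ braSpan R (B : Set L) (genS e k B)}
      add_mem' := by
        rintro a b ⟨ha, ha'⟩ ⟨hb, hb'⟩
        exact ⟨add_mem ha hb, fun y hy => by rw [lie_add]; exact add_mem (ha' y hy) (hb' y hy)⟩
      zero_mem' := ⟨zero_mem _, fun y hy => by rw [lie_zero]; exact zero_mem _⟩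
      smul_mem' := by
        rintro r a ⟨ha, ha'⟩
        exact ⟨B.smul_mem r ha, fun y hy => by rw [lie_smul]; exact Submodule.smul_mem _ r (ha' y hy)⟩ }
  have hW : EE e k B ≤ W := by
    apply EE_le
    · rintro v ⟨hv, hv'⟩ w ⟨hw, hw'⟩
      refine ⟨hs v hv w hw, fun y hy => ?_⟩
      have : ⁅y, ⁅v, w⁆⁆ = ⁅⁅y, v⁆, w⁆ - ⁅⁅y, w⁆, v⁆ := by
        rw [leibniz_lie y v w, ← lie_skew (⁅y, w⁆)]
        abel
      rw [this]
      exact sub_mem (hw' _ (hs y hy v hv)) (hv' _ (hs y hy w hw))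
    · intro x hx
      exact ⟨hx.1, fun y hy => mem_braSpan hy hx⟩
  exact (hW hv).2

lemma homog_step (he : Grad e) {k : ℕ} (hk1 : 1 ≤ k) (hkp : k < p) {B : Submodule R L} (hB : GrS e B)
    {v : L} (hv : v ∈ braSpan R (B : Set L) (genS e k B)) :
    e k v ∈ braSpan R (homC e k B) (homC e 0 B) ⊔ EE e (k + 1) B := by
  suffices hle : braSpan R (B : Set L) (genS e k B) ≤
      (braSpan R (homC e k B) (homC e 0 B) ⊔ EE e (k + 1) B).comap (e k) from hle hv
  apply braSpan_le
  rintro y hy x ⟨hx, b, hb, hbx⟩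
  rw [Submodule.mem_comap]
  rw [← hbx, he.bra]
  have hom : ∀ i z, z ∈ B → e i z ∈ homC e i B := fun i z hz => ⟨hB i z hz, he.idem i z⟩
  have hkv : ((k : ℕ) : ZMod p).val = k := ZMod.val_natCast_of_lt hkp
  by_cases hb0 : b = 0
  · subst hb0
    rw [sub_zero]
    exact Submodule.mem_sup_left (mem_braSpan (hom _ _ hy) (hom _ _ hx))
  have hb' : k ≤ b.val := hb.resolve_left hb0
  by_cases hbk : b.val = k
  · have : b = (k : ZMod p) := by rw [← hbk]; simp
    subst this
    rw [sub_self, ← lie_skew]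
    exact Submodule.mem_sup_left (neg_mem (mem_braSpan (hom _ _ hx) (hom _ _ hy)))
  · have hlt : k < b.val := lt_of_le_of_ne hb' (Ne.symm hbk)
    have hbp : b.val < p := ZMod.val_lt b
    have hval : ((k : ZMod p) - b).val = k + p - b.val := by
      have : (k : ZMod p) - b = ((k + p - b.val : ℕ) : ZMod p) := by
        rw [Nat.cast_sub (by omega)]
        simp
      rw [this, ZMod.val_natCast_of_lt (by omega)]
    refine Submodule.mem_sup_right (EE_lie (gen_mem ?_) (gen_mem ?_))
    · exact ⟨hB _ _ hy, _, Or.inr (by rw [hval]; omega), he.idem _ _⟩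
    · exact ⟨hB _ _ hx, _, Or.inr (by omega), he.idem _ _⟩

theorem kreknin_claim (he : Grad e) (m : ℕ)
    (hm : iterBra R Set.univ (homC e 0 (⊤ : Submodule R L)) m = ⊥) (k : ℕ) :
    k + 1 ≤ p → ∀ B : Submodule R L, IsSub B → GrS e B → Dser B (tt m k) ≤ EE e (k + 1) B := by
  induction k with
  | zero =>
    intro hk B hs hB x hx
    rw [← he.sum x]
    refine sum_mem fun i _ => gen_mem ⟨hB i x hx, i, ?_, he.idem i x⟩
    by_cases hi : i = 0
    · exact Or.inl hi
    · have : i.val ≠ 0 := by rwa [Ne, ZMod.val_eq_zero]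
      right; omega
  | succ k ih =>
    intro hk B hs hB
    set t := tt m k + 1 with ht
    set κ : ZMod p := ((k + 1 : ℕ) : ZMod p) with hκ
    have key : ∀ C : Submodule R L, IsSub C → GrS e C → ∀ x ∈ Dser C t,
        e κ x ∈ braSpan R (homC e κ C) (homC e 0 C) ⊔ EE e (k + 1 + 1) C := by
      intro C hCs hC x hx
      refine homog_step he (by omega) (by omega) hC ?_
      have h1 : Dser C t ≤ braSpan R (C : Set L) (genS e (k + 1) C) := by
        apply braSpan_le
        intro y hy z hz
        exact (bra_EE hCs (ih (by omega) C hCs hC hz)).2 y ((Dser_sub hCs _).2 hy)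
      exact h1 hx
    have h0E : ∀ x ∈ homC e 0 B, x ∈ EE e (k + 1 + 1) B := fun x hx =>
      gen_mem ⟨hx.1, 0, Or.inl rfl, hx.2⟩
    have iter : ∀ r : ℕ, ∀ x ∈ Dser B (r * t),
        e κ x ∈ iterBra R (homC e κ B) (homC e 0 B) r ⊔ EE e (k + 1 + 1) B := by
      intro r
      induction r with
      | zero =>
        intro x hx
        rw [zero_mul] at hx
        exact Submodule.mem_sup_left (Submodule.subset_span ⟨hB _ x hx, he.idem _ _⟩)
      | succ r ihr =>
        intro x hx
        rw [add_mul, one_mul, Dser_add] at hx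
        have hCB : Dser B (r * t) ≤ B := (Dser_sub hs _).2
        have h1 := key _ (Dser_sub hs (r * t)).1 (GrS_Dser he hB (r * t)) x hx
        refine sup_le (α := Submodule R L) ?_ ?_ h1
        · apply braSpan_le
          rintro y ⟨hy, hy'⟩ z ⟨hz, hz'⟩
          have hz0 : z ∈ homC e 0 B := ⟨hCB hz, hz'⟩
          have h2 := ihr y hy
          rw [hy'] at h2
          obtain ⟨y1, hy1, y2, hy2, rfl⟩ := Submodule.mem_sup.1 h2
          rw [add_lie]
          exact add_mem (Submodule.mem_sup_left (mem_iterBra_succ hy1 hz0))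
            (Submodule.mem_sup_right (EE_lie hy2 (h0E z hz0)))
        · exact (EE_mono hCB).trans le_sup_right
    have hfin : ∀ x ∈ Dser B (m * t), e κ x ∈ EE e (k + 1 + 1) B := by
      intro x hx
      have h1 := iter m x hx
      have h2 : iterBra R (homC e κ B) (homC e 0 B) m = ⊥ := by
        rw [eq_bot_iff, ← hm]
        exact iterBra_mono (Set.subset_univ _) (fun x (hx : x ∈ homC e 0 B) => (⟨trivial, hx.2⟩ : x ∈ homC e 0 ⊤)) m
      rwa [h2, bot_sup_eq] at h1
    change Dser B (m * t + tt m k) ≤ _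
    rw [Dser_add]
    have hCB : Dser B (m * t) ≤ B := (Dser_sub hs _).2
    refine (ih (by omega) _ (Dser_sub hs _).1 (GrS_Dser he hB _)).trans ?_
    refine EE_le (fun _ hx _ hy => EE_lie hx hy) ?_
    rintro x ⟨hx, i, hi, hix⟩
    by_cases hik : i.val = k + 1
    · have : i = κ := by rw [hκ, ← hik]; simp
      rw [← hix, this]
      exact hfin x hx
    · refine gen_mem ⟨hCB hx, i, ?_, hix⟩
      rcases hi with hi | hi
      · exact Or.inl hi
      · right; omega

theorem kreknin (he : Grad e) (m d : ℕ)
    (hm : iterBra R Set.univ (homC e 0 (⊤ : Submodule R L)) m = ⊥)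
    (B : Submodule R L) (hB0 : (B : Set L) = homC e 0 (⊤ : Submodule R L)) (hBs : IsSub B)
    (hd : Dser B d = ⊥) : Dser (⊤ : Submodule R L) (tt m (p - 1) + d) = ⊥ := by
  have hp := (Fact.out : p.Prime).one_lt
  have h1 := kreknin_claim he m hm (p - 1) (by omega) ⊤ (fun _ _ _ _ => trivial)
    (fun _ _ _ => trivial)
  rw [show p - 1 + 1 = p by omega] at h1
  have h2 : EE e p (⊤ : Submodule R L) ≤ B := by
    apply EE_le hBs
    rintro x ⟨_, i, hi, hix⟩
    have : i = 0 := hi.resolve_right (by have := ZMod.val_lt i; omega)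
    subst this
    change x ∈ (B : Set L)
    rw [hB0]
    exact ⟨trivial, hix⟩
  rw [Dser_add, eq_bot_iff, ← hd]
  exact Dser_mono (h1.trans h2) d

end kreknin

section final
variable {R L : Type*} [CommRing R] [LieRing L] [LieAlgebra R L]
variable {p : ℕ} [Fact p.Prime] {H : Type*} [Group H] [Fintype H] [DistribMulAction H (VV p)]
variable {ε : AddChar (ZMod p) R} {a : FHAct p H R L} {c d : ℕ}

/-- the projections -/
noncomputable def prj (ε : AddChar (ZMod p) R) (a : FHAct p H R L) (u : R) (x1 : VV p) (k : ZMod p) :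
    L →ₗ[R] L :=
  u • ∑ i : ZMod p, ε (-(i * k)) • a.U (i • x1)

lemma prj_apply (u : R) (x1 : VV p) (k : ZMod p) (x : L) :
    prj ε a u x1 k x = u • ∑ i : ZMod p, ε (-(i * k)) • a.U (i • x1) x := by
  simp [prj]

lemma U_prj (u : R) (x1 : VV p) (k j : ZMod p) (x : L) :
    a.U (j • x1) (prj ε a u x1 k x) = ε (j * k) • prj ε a u x1 k x := by
  rw [prj_apply, map_smul, smul_comm (ε (j * k)) u, map_sum, Finset.smul_sum (r := ε (j * k))]
  refine congrArg (fun y : L => u • y) ?_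
  refine Fintype.sum_equiv (Equiv.addLeft j) _ _ (fun i => ?_)
  rw [map_smul, ← a.U_add, ← add_smul, smul_smul, ← AddChar.map_add_eq_mul]
  simp only [Equiv.coe_addLeft]
  congr 2
  ring

lemma prj_of (u : R) (hu : u * p = 1) (x1 : VV p) (k : ZMod p) (x : L)
    (hx : ∀ j : ZMod p, a.U (j • x1) x = ε (j * k) • x) : prj ε a u x1 k x = x := by
  rw [prj_apply]
  have : ∀ i : ZMod p, ε (-(i * k)) • a.U (i • x1) x = x := by
    intro i
    rw [hx, smul_smul, ← AddChar.map_add_eq_mul]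
    simp
  simp only [this]
  rw [Finset.sum_const, Finset.card_univ, ZMod.card, ← Nat.cast_smul_eq_nsmul R, smul_smul, hu,
    one_smul]

lemma prj_grad (hy : LieHyp ε a c d) (u : R) (hu : u * p = 1) (x1 : VV p) :
    Grad (prj ε a u x1) where
  sum x := by
    simp only [prj_apply]
    rw [← Finset.smul_sum, Finset.sum_comm]
    simp only [← Finset.sum_smul]
    rw [Finset.sum_eq_single 0]
    · simp only [zero_mul, neg_zero, AddChar.map_zero_eq_one, Finset.sum_const, Finset.card_univ,
        ZMod.card, zero_smul, a.U_zero]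
      rw [nsmul_one, smul_smul, hu, one_smul]
    · intro i _ hi
      have := sum_mul_eq_zero ε hy.h0 (-i) (neg_ne_zero.2 hi)
      have h2 : ∀ k : ZMod p, -(i * k) = k * -i := fun k => by ring
      simp only [h2, this, zero_smul]
    · simp
  idem k x := prj_of u hu x1 k _ (fun j => U_prj u x1 k j x)
  bra k b x y := by
    set z := prj ε a u x1 b y with hz
    rw [prj_apply, prj_apply, smul_lie, sum_lie]
    congr 1
    refine Finset.sum_congr rfl fun i _ => ?_
    rw [hy.hU, hz, U_prj, lie_smul, smul_smul, smul_lie, ← AddChar.map_add_eq_mul]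
    congr 2
    ring

/-- the final bound -/
def bigN (p c d h : ℕ) : ℕ := n2 p c d h ^ (tt (n2 p c d h ^ d) (p - 1) + d)

theorem lie_nilpotent (hy : LieHyp ε a c d) (x1 : VV p) (hx1 : x1 ≠ 0)
    (hl : ∀ h : H, ∃ t : ZMod p, h • x1 = t • x1) :
    iterBra R (Set.univ : Set L) Set.univ (bigN p c d (Fintype.card H)) = ⊥ := by
  obtain ⟨u, hu⟩ := hy.hp.exists_left_inv
  set B : Submodule R L := LinearMap.eqLocus (a.U x1) LinearMap.id with hB
  have hBset : (B : Set L) = {x | a.U x1 x = x} := rfl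
  have hU1 : ∀ x, a.U x1 x = x → ∀ j : ZMod p, a.U (j • x1) x = x := by
    intro x hx j
    have h4 : j • x1 = j.val • x1 := by
      rw [← Nat.cast_smul_eq_nsmul (ZMod p)]; simp
    rw [h4]
    generalize j.val = n
    induction n with
    | zero => simp [a.U_zero]
    | succ n ih => rw [succ_nsmul', a.U_add, ih, hx]
  have hB0 : (B : Set L) = homC (prj ε a u x1) 0 (⊤ : Submodule R L) := by
    ext x
    constructor
    · intro hx
      refine ⟨trivial, prj_of u hu x1 0 x fun j => ?_⟩
      rw [hU1 x hx j]; simp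
    · rintro ⟨_, hx⟩
      change a.U x1 x = x
      have := U_prj (ε := ε) (a := a) u x1 0 1 x
      rw [hx] at this
      simpa using this
  have hBs : IsSub B := by
    intro x hx z hz
    change a.U x1 ⁅x, z⁆ = ⁅x, z⁆
    rw [hy.hU]
    congr 1
  have hBi : a.Inv B := by
    constructor
    · intro v x hx
      change a.U x1 (a.U v x) = a.U v x
      rw [← a.U_add, add_comm, a.U_add]
      congr 1
    · intro h x hx
      change a.U x1 (a.T h x) = a.T h x
      obtain ⟨t, ht⟩ := hl h
      have ht0 : t ≠ 0 := by
        rintro rfl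
        rw [zero_smul] at ht
        exact hx1 ((smul_eq_zero_iff_eq h).1 ht)
      have h5 : x1 = h • (t⁻¹ • x1) := by
        have : h • (t⁻¹ • x1) = t⁻¹ • (h • x1) :=
          ZMod.map_smul (DistribSMul.toAddMonoidHom (VV p) h) t⁻¹ x1
        rw [this, ht, smul_smul, inv_mul_cancel₀ ht0, one_smul]
      conv_lhs => rw [h5]
      rw [← a.comm, hU1 x hx]
  have hBd : Dser B d = ⊥ := by
    rw [eq_bot_iff, ← hy.h2 x1 hx1]
    exact Dser_le_iterBra hBs d
  have hTop : a.Inv ⊤ := ⟨fun _ _ _ => trivial, fun _ _ _ => trivial⟩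
  have h1 := solv hy d ⊤ B hTop hBi hBs hBd (fun _ _ _ _ => trivial)
  rw [hB0, Submodule.top_coe] at h1
  have h2 := kreknin (prj_grad hy u hu x1) _ d h1 B hB0 hBs hBd
  have h3 := solv hy _ ⊤ ⊤ hTop hTop (fun _ _ _ _ => trivial) h2 (fun _ _ _ _ => trivial)
  rw [Submodule.top_coe] at h3
  exact h3

end final
end FHAct

namespace FHAct

section bc
open scoped TensorProduct
variable {R L : Type*} [CommRing R] [LieRing L] [LieAlgebra R L]
variable {p : ℕ} [Fact p.Prime] {H : Type*} [Group H] [Fintype H] [DistribMulAction H (VV p)]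
variable (S : Type*) [CommRing S] [Algebra R S]

/-- base change of an action -/
def bc (a : FHAct p H R L) : FHAct p H S (S ⊗[R] L) where
  U v := (a.U v).baseChange S
  T v := (a.T v).baseChange S
  U_zero m := by
    rw [show a.U 0 = LinearMap.id from LinearMap.ext a.U_zero]; simp
  U_add u v m := by
    rw [show a.U (u + v) = a.U u ∘ₗ a.U v from LinearMap.ext (a.U_add u v), LinearMap.baseChange_comp]
    rfl
  T_one m := by
    rw [show a.T 1 = LinearMap.id from LinearMap.ext a.T_one]; simp
  comm h v m := by
    have : a.T h ∘ₗ a.U v = a.U (h • v) ∘ₗ a.T h := LinearMap.ext (a.comm h v)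
    have h2 := congrArg (LinearMap.baseChange S) this
    rw [LinearMap.baseChange_comp, LinearMap.baseChange_comp] at h2
    exact LinearMap.congr_fun h2 m

lemma bc_lie (f : L →ₗ[R] L) (hf : ∀ x y, f ⁅x, y⁆ = ⁅f x, f y⁆) (x y : S ⊗[R] L) :
    f.baseChange S ⁅x, y⁆ = ⁅f.baseChange S x, f.baseChange S y⁆ := by
  induction x using TensorProduct.induction_on with
  | zero => simp
  | add x x' h h' => rw [add_lie, map_add, map_add, add_lie, h, h']
  | tmul s x =>
    induction y using TensorProduct.induction_on with
    | zero => simp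
    | add y y' h h' => rw [lie_add, map_add, map_add, lie_add, h, h']
    | tmul t y => simp [LieAlgebra.ExtendScalars.bracket_tmul, hf]

lemma bc_mem (f : L →ₗ[R] L) (x : S ⊗[R] L) :
    f.baseChange S x ∈ (LinearMap.range f).baseChange S := by
  induction x using TensorProduct.induction_on with
  | zero => simp
  | add x x' h h' => rw [map_add]; exact add_mem h h'
  | tmul s x => exact Submodule.tmul_mem_baseChange_of_mem s ⟨x, rfl⟩

lemma bc_mono {X Y : Submodule R L} (h : X ≤ Y) : X.baseChange S ≤ Y.baseChange S := by
  rw [Submodule.baseChange_eq_span, Submodule.baseChange_eq_span]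
  exact Submodule.span_mono (Set.image_mono h)

lemma braSpan_bc (X Y : Submodule R L) :
    braSpan S (X.baseChange S : Set (S ⊗[R] L)) (Y.baseChange S : Set (S ⊗[R] L)) ≤
      (braSpan R (X : Set L) (Y : Set L)).baseChange S := by
  apply braSpan_le
  rintro _ ⟨x, rfl⟩ _ ⟨y, rfl⟩
  induction x using TensorProduct.induction_on with
  | zero => simp
  | add x x' h h' => rw [map_add, add_lie]; exact add_mem h h'
  | tmul s x =>
    induction y using TensorProduct.induction_on with
    | zero => simp
    | add y y' h h' => rw [map_add, lie_add]; exact add_mem h h'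
    | tmul t y =>
      simp only [LinearMap.baseChange_tmul, LieAlgebra.ExtendScalars.bracket_tmul]
      exact Submodule.tmul_mem_baseChange_of_mem _ (mem_braSpan x.2 y.2)

lemma iterBra_bc (X Y : Submodule R L) (n : ℕ) :
    iterBra S (X.baseChange S : Set (S ⊗[R] L)) (Y.baseChange S : Set (S ⊗[R] L)) n ≤
      (iterBra R (X : Set L) (Y : Set L) n).baseChange S := by
  induction n with
  | zero =>
    change Submodule.span _ _ ≤ (Submodule.span R (X : Set L)).baseChange S
    rw [Submodule.span_eq, Submodule.span_eq]
  | succ n ih => exact (braSpan_mono ih le_rfl).trans (braSpan_bc S _ _)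

lemma iterBra_one_tmul (n : ℕ) (z : L) (hz : z ∈ iterBra R (Set.univ : Set L) Set.univ n) :
    (1 : S) ⊗ₜ[R] z ∈ iterBra S (Set.univ : Set (S ⊗[R] L)) Set.univ n := by
  suffices h : iterBra R (Set.univ : Set L) Set.univ n ≤
      ((iterBra S (Set.univ : Set (S ⊗[R] L)) Set.univ n).restrictScalars R).comap
        (TensorProduct.mk R S L 1) from h hz
  clear hz z
  induction n with
  | zero => exact Submodule.span_le.2 fun x _ => Submodule.subset_span trivial
  | succ n ih =>
    apply braSpan_le
    intro x hx y _
    have h1 : (1 : S) ⊗ₜ[R] x ∈ iterBra S (Set.univ : Set (S ⊗[R] L)) Set.univ n := ih hx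
    have h2 := mem_iterBra_succ h1 (Set.mem_univ ((1 : S) ⊗ₜ[R] y))
    rw [LieAlgebra.ExtendScalars.bracket_tmul, one_mul] at h2
    exact h2

variable {S} in
theorem nilp_of_ext (ε : AddChar (ZMod p) S) (h0 : ∑ z, ε z = 0)
    (hinj : Function.Injective (TensorProduct.mk R S L 1)) (a : FHAct p H R L) {c d : ℕ}
    (hp : IsUnit (p : R))
    (frob : ∀ h : H, h ≠ 1 → ∀ v : VV p, h • v = v → v = 0)
    (hU : ∀ v x y, a.U v ⁅x, y⁆ = ⁅a.U v x, a.U v y⁆)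
    (hT : ∀ v x y, a.T v ⁅x, y⁆ = ⁅a.T v x, a.T v y⁆)
    (h1 : iterBra R (Set.range a.tr) (Set.range a.tr) c = ⊥)
    (h2 : ∀ v ≠ 0, iterBra R {x | a.U v x = x} {x | a.U v x = x} d = ⊥)
    (x1 : VV p) (hx1 : x1 ≠ 0) (hl : ∀ h : H, ∃ t : ZMod p, h • x1 = t • x1) :
    iterBra R (Set.univ : Set L) Set.univ (bigN p c d (Fintype.card H)) = ⊥ := by
  have hpS : IsUnit (p : S) := by
    have := hp.map (algebraMap R S)
    rwa [map_natCast] at this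
  have hy : LieHyp ε (a.bc S) c d :=
    { h0 := h0
      hp := hpS
      frob := frob
      hU := fun v x y => bc_lie S (a.U v) (hU v) x y
      hT := fun v x y => bc_lie S (a.T v) (hT v) x y
      h1 := by
        have hsub : Set.range (a.bc S).tr ⊆ ((LinearMap.range a.tr).baseChange S : Set (S ⊗[R] L)) := by
          rintro _ ⟨x, rfl⟩
          have e : (a.bc S).tr x = a.tr.baseChange S x := by
            simp only [tr, bc]
            induction x using TensorProduct.induction_on with
            | zero => simp
            | add x x' h h' => rw [map_add, map_add, h, h']
            | tmul s x => simp [TensorProduct.tmul_sum]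
          rw [e]
          exact bc_mem S _ x
        have h3 := (iterBra_mono (R := S) hsub hsub c).trans (iterBra_bc S _ _ c)
        rw [LinearMap.coe_range, h1, Submodule.baseChange_bot] at h3
        exact eq_bot_iff.2 h3
      h2 := by
        intro v hv
        have hsub : {x | (a.bc S).U v x = x} ⊆
            ((LinearMap.eqLocus (a.U v) LinearMap.id).baseChange S : Set (S ⊗[R] L)) := by
          intro x hx
          set σ : L →ₗ[R] L := ∑ i : ZMod p, a.U (i • v) with hσ
          have hσr : LinearMap.range σ ≤ LinearMap.eqLocus (a.U v) LinearMap.id := by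
            rintro _ ⟨x, rfl⟩
            change a.U v (σ x) = σ x
            rw [hσ, LinearMap.sum_apply, map_sum]
            refine Fintype.sum_equiv (Equiv.addLeft 1) _ _ (fun i => ?_)
            rw [← a.U_add]
            simp [add_smul]
          have hpv : ∀ i : ℕ, (a.bc S).U (i • v) x = x := by
            intro i
            induction i with
            | zero => simp [(a.bc S).U_zero]
            | succ n ih =>
              rw [succ_nsmul', (a.bc S).U_add, ih]
              exact hx
          have hpv' : ∀ i : ZMod p, (a.U (i • v)).baseChange S x = x := by
            intro i
            have h4 : i • v = i.val • v := by
              rw [← Nat.cast_smul_eq_nsmul (ZMod p)]; simp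
            rw [h4]
            exact hpv i.val
          have e1 : ∀ x, σ.baseChange S x = ∑ i : ZMod p, (a.U (i • v)).baseChange S x := by
            intro x
            clear * -
            induction x using TensorProduct.induction_on with
            | zero => simp
            | add x x' h h' => simp only [map_add, h, h', Finset.sum_add_distrib]
            | tmul s x => simp [σ, TensorProduct.tmul_sum]
          have e2 : σ.baseChange S x = (p : S) • x := by
            rw [e1]
            simp only [hpv']
            simp [ZMod.card, Nat.cast_smul_eq_nsmul]
          have h5 := bc_mono S hσr (bc_mem S σ x)
          rw [e2] at h5
          obtain ⟨u, hu⟩ := hpS.exists_left_inv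
          have h6 := Submodule.smul_mem _ u h5
          rwa [smul_smul, hu, one_smul] at h6
        have h3 := (iterBra_mono (R := S) hsub hsub d).trans (iterBra_bc S _ _ d)
        have h4 : iterBra R (LinearMap.eqLocus (a.U v) LinearMap.id : Set L)
          (LinearMap.eqLocus (a.U v) LinearMap.id : Set L) d = ⊥ := h2 v hv
        rw [h4, Submodule.baseChange_bot] at h3
        exact eq_bot_iff.2 h3 }
  have h7 := lie_nilpotent hy x1 hx1 hl
  rw [eq_bot_iff]
  intro z hz
  have h8 := iterBra_one_tmul S _ z hz
  rw [h7, Submodule.mem_bot] at h8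
  have h9 : z = 0 := hinj (by simpa using h8)
  exact h9

theorem nilp (a : FHAct p H R L) {c d : ℕ}
    (hp : IsUnit (p : R))
    (frob : ∀ h : H, h ≠ 1 → ∀ v : VV p, h • v = v → v = 0)
    (hU : ∀ v x y, a.U v ⁅x, y⁆ = ⁅a.U v x, a.U v y⁆)
    (hT : ∀ v x y, a.T v ⁅x, y⁆ = ⁅a.T v x, a.T v y⁆)
    (h1 : iterBra R (Set.range a.tr) (Set.range a.tr) c = ⊥)
    (h2 : ∀ v ≠ 0, iterBra R {x | a.U v x = x} {x | a.U v x = x} d = ⊥)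
    (x1 : VV p) (hx1 : x1 ≠ 0) (hl : ∀ h : H, ∃ t : ZMod p, h • x1 = t • x1) :
    iterBra R (Set.univ : Set L) Set.univ (bigN p c d (Fintype.card H)) = ⊥ := by
  rcases subsingleton_or_nontrivial R with hR | hR
  · rw [eq_bot_iff]
    intro z _
    have : z = 0 := by rw [← one_smul R z, Subsingleton.elim (1 : R) 0, zero_smul]
    exact this
  have hpp : p.Prime := Fact.out
  let f := Polynomial.cyclotomic p R
  have hf : f.Monic := Polynomial.cyclotomic.monic p R
  have : Module.Free R (AdjoinRoot f) := hf.free_adjoinRoot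
  have : Nontrivial (AdjoinRoot f) := by
    have hdeg : 0 < f.natDegree := by
      rw [Polynomial.natDegree_cyclotomic]
      exact Nat.totient_pos.2 hpp.pos
    have hne : Nonempty (Fin (AdjoinRoot.powerBasis' hf).dim) := by
      rw [AdjoinRoot.powerBasis'_dim]
      exact ⟨⟨0, hdeg⟩⟩
    exact (AdjoinRoot.powerBasis' hf).basis.repr.toEquiv.nontrivial
  let ω := AdjoinRoot.root f
  have hs : ∑ i ∈ Finset.range p, ω ^ i = 0 := by
    have h3 : Polynomial.aeval ω f = 0 := by
      rw [AdjoinRoot.aeval_eq, AdjoinRoot.mk_self]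
    have h4 : f = ∑ i ∈ Finset.range p, Polynomial.X ^ i := Polynomial.cyclotomic_prime R p
    have h5 := congrArg (Polynomial.aeval ω) h4
    rw [h3, map_sum] at h5
    simpa using h5.symm
  have hω : ω ^ p = 1 := by
    have h3 := geom_sum_mul ω p
    rw [hs, zero_mul] at h3
    exact (sub_eq_zero.1 h3.symm)
  refine nilp_of_ext (AddChar.zmodChar p hω) ?_
    (Module.FaithfullyFlat.tensorProduct_mk_injective (A := R) (B := AdjoinRoot f) L) a hp frob hU hT h1 h2 x1
    hx1 hl
  rw [← hs]
  refine Finset.sum_bij (fun z _ => z.val) ?_ ?_ ?_ ?_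
  · intro z _
    exact Finset.mem_range.2 (ZMod.val_lt z)
  · intro x _ y _ h
    exact ZMod.val_injective p h
  · intro n hn
    exact ⟨n, Finset.mem_univ _, ZMod.val_natCast_of_lt (Finset.mem_range.1 hn)⟩
  · intro z _
    rw [AddChar.zmodChar_apply]

end bc
end FHAct

namespace FHAct

section grp

lemma exists_line {A : Type*} [Group A] [Finite A] (F : Subgroup A) (hF : F.Normal) (hne : F ≠ ⊥)
    (p : ℕ) (hp : p.Prime) (hexp : ∀ f ∈ F, f ^ p = 1) (hs : IsSupersolvable A) :
    ∃ x ∈ F, x ≠ 1 ∧ ∀ g : A, ∃ n : ℤ, g * x * g⁻¹ = x ^ n := by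
  classical
  have : Fact p.Prime := ⟨hp⟩
  obtain ⟨n, s, h0, hn, hnorm, hcyc⟩ := hs
  have hex : ∃ i, s i ⊓ F ≠ ⊥ := ⟨n, by rw [hn, top_inf_eq]; exact hne⟩
  have hmin := fun m => Nat.find_min hex (m := m)
  have hspec := Nat.find_spec hex
  have hle : Nat.find hex ≤ n := Nat.find_min' hex (by rw [hn, top_inf_eq]; exact hne)
  obtain ⟨j, hj⟩ : ∃ j, Nat.find hex = j + 1 := by
    refine Nat.exists_eq_succ_of_ne_zero fun h => ?_
    rw [h, h0, bot_inf_eq] at hspec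
    exact hspec rfl
  rw [hj] at hspec hle hmin
  have hjbot : s j ⊓ F = ⊥ := not_not.1 (hmin j (Nat.lt_succ_self j))
  obtain ⟨g, hg⟩ := hcyc j (by omega)
  set N := s (j + 1) ⊓ F with hN
  have hNn : N.Normal := by
    have := hnorm (j + 1)
    exact Subgroup.normal_inf_normal _ _
  have := hnorm j
  let q := QuotientGroup.mk' (s j)
  have hq : ∀ x ∈ N, q x ∈ Subgroup.zpowers (q g) := by
    intro x hx
    have hx' : x ∈ s j ⊔ Subgroup.zpowers g := hg ▸ hx.1
    obtain ⟨a, ha, b, hb, rfl⟩ := Subgroup.mem_sup_of_normal_left.1 hx'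
    rw [map_mul, show q a = 1 from (QuotientGroup.eq_one_iff a).2 ha, one_mul]
    obtain ⟨k, rfl⟩ := hb
    exact ⟨k, by simp⟩
  let f : N →* Subgroup.zpowers (q g) := (q.comp N.subtype).codRestrict _ (fun x => hq x x.2)
  have hf : Function.Injective f := by
    rw [injective_iff_map_eq_one]
    intro x hx
    have h1 : q x = 1 := congrArg Subtype.val hx
    have h2 : (x : A) ∈ s j := (QuotientGroup.eq_one_iff _).1 h1
    have h3 : (x : A) ∈ s j ⊓ F := ⟨h2, x.2.2⟩
    rw [hjbot] at h3
    exact Subtype.ext h3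
  have hNc : IsCyclic N := isCyclic_of_injective f hf
  obtain ⟨g0, hg0⟩ := hNc.exists_generator
  have hcard : Nat.card N = p := by
    have h1 : orderOf g0 = Nat.card N := orderOf_eq_card_of_forall_mem_zpowers hg0
    have h2 : orderOf g0 ∣ p := orderOf_dvd_of_pow_eq_one (Subtype.ext (hexp g0 g0.2.2))
    rcases (Nat.dvd_prime hp).1 h2 with h3 | h3
    · rw [h3] at h1
      exact absurd (Subgroup.eq_bot_of_card_eq N h1.symm) hspec
    · rw [← h1, h3]
  obtain ⟨x, hx, hx1⟩ := (Subgroup.ne_bot_iff_exists_ne_one (H := N)).1 hspec |>.elim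
    (fun x hx => (⟨x, x.2, fun h => hx (Subtype.ext h)⟩ : ∃ x : A, x ∈ N ∧ x ≠ 1))
  refine ⟨x, hx.2, hx1, fun g => ?_⟩
  have h4 := mem_zpowers_of_prime_card (G := N) (g := ⟨x, hx⟩) (g' := ⟨g * x * g⁻¹, hNn.conj_mem x hx g⟩)
    hcard (fun h => hx1 (congrArg Subtype.val h))
  obtain ⟨k, hk⟩ := h4
  exact ⟨k, (congrArg Subtype.val hk).symm⟩

lemma exists_iso {G : Type*} [CommGroup G] [Finite G] (p : ℕ) [Fact p.Prime]
    (hc : Nat.card G = p ^ 2) (hexp : ∀ f : G, f ^ p = 1) :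
    ∃ φ : VV p → G, (∀ u v, φ (u + v) = φ u * φ v) ∧ Function.Bijective φ := by
  let _ : Module (ZMod p) (Additive G) := AddCommGroup.zmodModule (n := p) (fun x => hexp x)
  have hfin : Finite (Additive G) := inferInstanceAs (Finite G)
  have : Module.Finite (ZMod p) (Additive G) := Module.Finite.of_finite
  have h1 : Nat.card (Additive G) = p ^ Module.finrank (ZMod p) (Additive G) := by
    rw [Module.natCard_eq_pow_finrank (K := ZMod p), Nat.card_zmod]
  have h2 : Module.finrank (ZMod p) (Additive G) = 2 := by
    have h3 : Nat.card (Additive G) = p ^ 2 := hc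
    rw [h3] at h1
    exact (Nat.pow_right_injective (Fact.out : p.Prime).two_le h1).symm
  let e : VV p ≃ₗ[ZMod p] Additive G := LinearEquiv.ofFinrankEq _ _ (by rw [h2]; simp)
  exact ⟨fun v => (e v).toMul, fun u v => congrArg Additive.toMul (map_add e u v), e.bijective⟩

end grp
end FHAct

/-- For every prime `p` and positive integers `c`, `d`, `h` there is `N = N(c, d, p, h)`
such that: if a supersolvable Frobenius group `FH` (here the finite group `A` with normal
subgroup `F` and complement `H`) with kernel `F` elementary abelian of order `p^2` and
complement `H` of order `h` acts by Lie-algebra automorphisms on a Lie algebra `L` over a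
commutative ring `R` with finite additive group in which `p` is invertible, and `C_L(H)` is
nilpotent of class at most `c` while `C_L(x)` is nilpotent of class at most `d` for every
`x ∈ F^#`, then `L` is nilpotent of class at most `N`.  (Nilpotency of class at most `n`
is expressed by the vanishing of all left-normed brackets with `n + 1` entries.) -/
theorem frobenius_action_on_lie_algebra_nilpotent_bounded_class
    (p : ℕ) (hp : p.Prime) (c d h : ℕ) (hc : 0 < c) (hd : 0 < d) (hh : 0 < h) :
    ∃ N : ℕ, ∀ (A : Type*) [Group A] [Finite A] (F H : Subgroup A),
      F.Normal → F ⊓ H = ⊥ → F ⊔ H = ⊤ → F ≠ ⊥ → H ≠ ⊥ →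
      (∀ x ∈ H, x ≠ 1 → ∀ f ∈ F, x * f = f * x → f = 1) →
      IsSupersolvable A →
      Nat.card F = p ^ 2 → (∀ f ∈ F, f ^ p = 1) → (∀ f ∈ F, ∀ g ∈ F, f * g = g * f) →
      Nat.card H = h →
      ∀ (R : Type*) [CommRing R] [Finite R], IsUnit (p : R) →
      ∀ (L : Type*) [LieRing L] [LieAlgebra R L] (ρ : A → (L ≃ₗ⁅R⁆ L)),
        (∀ x : L, ρ 1 x = x) →
        (∀ g₁ g₂ : A, ∀ x : L, ρ (g₁ * g₂) x = ρ g₁ (ρ g₂ x)) →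
        iterBra R (fixSub ρ (H : Set A) : Set L) (fixSub ρ (H : Set A) : Set L) c = ⊥ →
        (∀ x ∈ F, x ≠ 1 →
          iterBra R (fixSub ρ {x} : Set L) (fixSub ρ {x} : Set L) d = ⊥) →
        iterBra R (Set.univ : Set L) (Set.univ : Set L) N = ⊥ := by
  have hpF : Fact p.Prime := ⟨hp⟩
  refine ⟨FHAct.bigN p c d h, ?_⟩
  intro A _ _ F H hFn hFH hFHt hF hH hfrob hss hcF hexp hcomm hcH R _ _ hpR L _ _ ρ hρ1 hρm hfix hfixF
  classical
  have : Fintype H := Fintype.ofFinite H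
  obtain ⟨x, hxF, hx1, hxl⟩ := FHAct.exists_line F hFn hF p hp hexp hss
  obtain ⟨φ, hφF, hφadd, hφinj, hφsurj⟩ : ∃ φ : VV p → A, (∀ v, φ v ∈ F) ∧
      (∀ u v, φ (u + v) = φ u * φ v) ∧ Function.Injective φ ∧ ∀ f ∈ F, ∃ v, φ v = f := by
    let _ : CommGroup F := { (inferInstance : Group F) with
      mul_comm := fun a b => Subtype.ext (hcomm a a.2 b b.2) }
    obtain ⟨φ, h1, h2, h3⟩ := FHAct.exists_iso (G := F) p hcF (fun f => Subtype.ext (hexp f f.2))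
    refine ⟨fun v => φ v, fun v => (φ v).2, fun u v => congrArg Subtype.val (h1 u v),
      fun u v huv => h2 (Subtype.ext huv), fun f hf => ?_⟩
    obtain ⟨v, hv⟩ := h3 ⟨f, hf⟩
    exact ⟨v, congrArg Subtype.val hv⟩
  have hφ0 : φ 0 = 1 := by
    have := hφadd 0 0
    rw [add_zero] at this
    exact (mul_eq_left.1 this.symm)
  have hconj : ∀ (k : H) (v : VV p), ∃ w, φ w = k * φ v * (k : A)⁻¹ := fun k v =>
    hφsurj _ (hFn.conj_mem _ (hφF v) k)
  choose act hact using hconj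
  let _ : DistribMulAction H (VV p) :=
    { smul := act
      one_smul := fun v => hφinj (by
        change φ (act 1 v) = φ v
        rw [hact]; simp)
      mul_smul := fun k l v => hφinj (by
        change φ (act (k * l) v) = φ (act k (act l v))
        rw [hact, hact, hact]; simp [mul_assoc])
      smul_zero := fun k => hφinj (by
        change φ (act k 0) = φ 0
        rw [hact, hφ0]; simp)
      smul_add := fun k u v => hφinj (by
        change φ (act k (u + v)) = φ (act k u + act k v)
        rw [hact, hφadd, hφadd, hact, hact]; simp [mul_assoc]) }
  have hact' : ∀ (k : H) (v : VV p), φ (k • v) = k * φ v * (k : A)⁻¹ := hact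
  let a : FHAct p H R L :=
    { U := fun v => (ρ (φ v)).toLieHom.toLinearMap
      T := fun k => (ρ k).toLieHom.toLinearMap
      U_zero := fun m => by
        change ρ (φ 0) m = m
        rw [hφ0, hρ1]
      U_add := fun u v m => by
        change ρ (φ (u + v)) m = ρ (φ u) (ρ (φ v) m)
        rw [hφadd, hρm]
      T_one := fun m => hρ1 m
      comm := fun k v m => by
        change ρ k (ρ (φ v) m) = ρ (φ (k • v)) (ρ k m)
        rw [hact', ← hρm, ← hρm]
        simp }
  have hcard : Fintype.card H = h := by rw [← hcH, Nat.card_eq_fintype_card]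
  obtain ⟨x1, hx1φ⟩ := hφsurj x hxF
  rw [← hcard]
  refine FHAct.nilp a hpR ?_ ?_ ?_ ?_ ?_ x1 ?_ ?_
  · intro k hk v hv
    apply hφinj
    rw [hφ0]
    refine hfrob k k.2 (fun h => hk (Subtype.ext h)) _ (hφF v) ?_
    have h1 := hact' k v
    rw [hv] at h1
    exact (eq_mul_inv_iff_mul_eq.1 h1).symm
  · exact fun v y z => (ρ (φ v)).toLieHom.map_lie y z
  · exact fun v y z => (ρ v).toLieHom.map_lie y z
  · have hsub : Set.range a.tr ⊆ (fixSub ρ (H : Set A) : Set L) := by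
      rintro _ ⟨m, rfl⟩
      intro g hg
      rw [FHAct.CommHyp.tr_apply]
      change (ρ g).toLieHom.toLinearMap (∑ k : H, a.T k m) = _
      rw [map_sum]
      refine Fintype.sum_equiv (Equiv.mulLeft (⟨g, hg⟩ : H)) _ _ (fun k => ?_)
      exact (hρm g k m).symm
    rw [eq_bot_iff, ← hfix]
    exact FHAct.iterBra_mono hsub hsub c
  · intro v hv
    have hne : φ v ≠ 1 := fun h => hv (hφinj (h.trans hφ0.symm))
    have hsub : {y | a.U v y = y} ⊆ (fixSub ρ {φ v} : Set L) := by
      intro y hy g hg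
      rw [show g = φ v from hg]
      exact hy
    rw [eq_bot_iff, ← hfixF _ (hφF v) hne]
    exact FHAct.iterBra_mono hsub hsub d
  · rintro rfl
    exact hx1 (hx1φ.symm.trans hφ0)
  · intro k
    obtain ⟨n, hn⟩ := hxl k
    refine ⟨(n : ZMod p), hφinj ?_⟩
    rw [hact', hx1φ, hn, ← hx1φ]
    let Φ : Multiplicative (VV p) →* A := MonoidHom.mk' (fun v => φ v.toAdd) (fun u v => hφadd _ _)
    have h1 := map_zpow Φ (Multiplicative.ofAdd x1) n
    rw [Int.cast_smul_eq_zsmul]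
    exact h1.symm
end

section
/- For every prime p and all positive integers u and v there exists a number N = N(p,u,v) with the following property: let L be a Lie algebra graded by ℤ/pℤ, i.e., L = ⊕_{i∈ℤ/pℤ} L_i with [L_i, L_j] ⊆ L_{i+j}. If [L, L_0, …, L_0] = 0 (with L_0 occurring u times) and [[L,L] ∩ L_0, L_a, …, L_a] = 0 (with L_a occurring v times) for every a ∈ ℤ/pℤ, then L is nilpotent of nilpotency class at most N. -/
section Helpers

variable {R : Type*} {L : Type*} [CommRing R] [LieRing L] [LieAlgebra R L] {p : ℕ}

theorem braSpan_le {S T : Set L} {M : Submodule R L}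
    (h : ∀ x ∈ S, ∀ y ∈ T, ⁅x, y⁆ ∈ M) : braSpan R S T ≤ M := by
  refine Submodule.span_le.2 ?_
  rintro z ⟨x, hx, y, hy, rfl⟩
  exact h x hx y hy

theorem mem_braSpan {S T : Set L} {x y : L} (hx : x ∈ S) (hy : y ∈ T) :
    ⁅x, y⁆ ∈ braSpan R S T := Submodule.subset_span ⟨x, hx, y, hy, rfl⟩

theorem iterBra_mono {S S' T T' : Set L} (hS : S ⊆ S') (hT : T ⊆ T') (n : ℕ) :
    iterBra R S T n ≤ iterBra R S' T' n := by
  induction n with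
  | zero => exact Submodule.span_mono hS
  | succ n ih => exact braSpan_le fun x hx y hy => mem_braSpan (ih hx) (hT hy)

/-- A family compatible with brackets. -/
def Nice (V : ZMod p → Submodule R L) : Prop :=
  ∀ i j : ZMod p, ∀ x ∈ V i, ∀ y ∈ V j, ⁅x, y⁆ ∈ V (i + j)

/-- The derived family. -/
def Dfam (V : ZMod p → Submodule R L) (i : ZMod p) : Submodule R L :=
  Submodule.span R {z | ∃ a b, a + b = i ∧ ∃ x ∈ V a, ∃ y ∈ V b, ⁅x, y⁆ = z}

theorem Dfam_le {V : ZMod p → Submodule R L} (h : Nice V) : Dfam V ≤ V := by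
  intro i
  refine Submodule.span_le.2 ?_
  rintro z ⟨a, b, rfl, x, hx, y, hy, rfl⟩
  exact h a b x hx y hy

theorem mem_Dfam {V : ZMod p → Submodule R L} {a b : ZMod p} {x y : L} (hx : x ∈ V a)
    (hy : y ∈ V b) : ⁅x, y⁆ ∈ Dfam V (a + b) :=
  Submodule.subset_span ⟨a, b, rfl, x, hx, y, hy, rfl⟩

theorem Dfam_nice {V : ZMod p → Submodule R L} (h : Nice V) : Nice (Dfam V) :=
  fun _ _ _ hx _ hy => mem_Dfam (Dfam_le h _ hx) (Dfam_le h _ hy)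

theorem Dit_nice {V : ZMod p → Submodule R L} (h : Nice V) (n : ℕ) : Nice (Dfam^[n] V) := by
  induction n with
  | zero => exact h
  | succ n ih => rw [Function.iterate_succ_apply']; exact Dfam_nice ih

theorem Dit_le {V : ZMod p → Submodule R L} (h : Nice V) (n : ℕ) : Dfam^[n] V ≤ V := by
  induction n with
  | zero => exact le_rfl
  | succ n ih => rw [Function.iterate_succ_apply']; exact (Dfam_le (Dit_nice h n)).trans ih

/-- Homogeneous components of the subalgebra generated by `V j`, `j ≥ k`. -/
inductive Gen (V : ZMod p → Submodule R L) (k : ℕ) : ZMod p → L → Prop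
  | base (j : ZMod p) (x : L) : k ≤ j.val → x ∈ V j → Gen V k j x
  | bra (i j : ZMod p) (x y : L) : Gen V k i x → Gen V k j y → Gen V k (i + j) ⁅x, y⁆
  | zero (i : ZMod p) : Gen V k i 0
  | add (i : ZMod p) (x y : L) : Gen V k i x → Gen V k i y → Gen V k i (x + y)
  | smul (i : ZMod p) (r : R) (x : L) : Gen V k i x → Gen V k i (r • x)

/-- The submodule of elements satisfying `Gen`. -/
def genSub (V : ZMod p → Submodule R L) (k : ℕ) (i : ZMod p) : Submodule R L where
  carrier := {x | Gen V k i x}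
  zero_mem' := Gen.zero i
  add_mem' := fun hx hy => Gen.add i _ _ hx hy
  smul_mem' := fun r _ hx => Gen.smul i r _ hx

theorem mem_genSub {V : ZMod p → Submodule R L} {k : ℕ} {i : ZMod p} {x : L} :
    x ∈ genSub V k i ↔ Gen V k i x := Iff.rfl

theorem Gen.trans {V W : ZMod p → Submodule R L} {k l : ℕ}
    (h : ∀ j : ZMod p, k ≤ j.val → W j ≤ genSub V l j) {i : ZMod p} {x : L}
    (hx : Gen W k i x) : Gen V l i x := by
  induction hx with
  | base j x hj hx => exact h j hj hx
  | bra i j x y _ _ ih1 ih2 => exact Gen.bra i j x y ih1 ih2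
  | zero i => exact Gen.zero i
  | add i x y _ _ ih1 ih2 => exact Gen.add i x y ih1 ih2
  | smul i r x _ ih => exact Gen.smul i r x ih

theorem Gen.lie_zero {V : ZMod p → Submodule R L} (hV : Nice V) {k : ℕ} {i : ZMod p} {x : L}
    (hx : Gen V k i x) : ∀ y ∈ V 0, Gen V k i ⁅x, y⁆ := by
  induction hx with
  | base j x hj hx =>
    intro y hy
    exact Gen.base j _ hj (by simpa using hV j 0 x hx y hy)
  | bra i j x y _ _ ih1 ih2 =>
    intro z hz
    have : ⁅⁅x, y⁆, z⁆ = ⁅⁅x, z⁆, y⁆ + ⁅x, ⁅y, z⁆⁆ := by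
      rw [lie_lie x y z, ← lie_skew ⁅x, z⁆ y]; abel
    rw [this]
    exact Gen.add _ _ _ (Gen.bra _ _ _ _ (ih1 z hz) (by assumption))
      (Gen.bra _ _ _ _ (by assumption) (ih2 z hz))
  | zero i => intro y _; simpa using Gen.zero i
  | add i x y _ _ ih1 ih2 =>
    intro z hz
    rw [add_lie]; exact Gen.add i _ _ (ih1 z hz) (ih2 z hz)
  | smul i r x _ ih =>
    intro z hz
    rw [smul_lie]; exact Gen.smul i r _ (ih z hz)

theorem Gen.mem {V : ZMod p → Submodule R L} (hV : Nice V) {k : ℕ} {i : ZMod p} {x : L}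
    (hx : Gen V k i x) : x ∈ V i := by
  induction hx with
  | base j x hj hx => exact hx
  | bra i j x y _ _ ih1 ih2 => exact hV i j x ih1 y ih2
  | zero i => exact zero_mem _
  | add i x y _ _ ih1 ih2 => exact add_mem ih1 ih2
  | smul i r x _ ih => exact Submodule.smul_mem _ r ih

theorem lemmaB [NeZero p] {V : ZMod p → Submodule R L} (hV : Nice V) {k : ℕ} (hk : k < p)
    {j : ZMod p} {y : L} (hy : Gen V k j y) :
    ∀ (i : ZMod p) (x : L), x ∈ V i → i + j = (k : ZMod p) →
      ⁅x, y⁆ ∈ genSub V (k + 1) (k : ZMod p) ⊔ braSpan R (V (k : ZMod p)) (V 0) := by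
  induction hy with
  | base j y hj hy =>
    intro i x hx hij
    rcases hj.eq_or_lt with h | h
    · have hjk : j = (k : ZMod p) := by rw [h]; simp
      have hi : i = 0 := by rw [hjk] at hij; simpa using hij
      subst hi
      rw [← lie_skew]
      refine Submodule.mem_sup_right (neg_mem (mem_braSpan ?_ hx))
      rw [← hjk]; exact hy
    · refine Submodule.mem_sup_left ?_
      rw [← hij]
      refine Gen.bra _ _ _ _ (Gen.base _ _ ?_ hx) (Gen.base _ _ h hy)
      have h1 : ((i.val + j.val : ℕ) : ZMod p) = (k : ℕ) := by
        push_cast; simpa using hij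
      rw [ZMod.natCast_eq_natCast_iff'] at h1
      rw [Nat.mod_eq_of_lt hk] at h1
      have hj' := ZMod.val_lt j
      have hi' := ZMod.val_lt i
      by_contra hcon
      rcases lt_or_ge (i.val + j.val) p with h2 | h2
      · rw [Nat.mod_eq_of_lt h2] at h1; omega
      · rw [Nat.mod_eq_sub_mod h2, Nat.mod_eq_of_lt (by omega)] at h1; omega
  | bra a b y z hy1 hy2 ih1 ih2 =>
    intro i x hx hij
    have : ⁅x, ⁅y, z⁆⁆ = ⁅⁅x, y⁆, z⁆ - ⁅⁅x, z⁆, y⁆ := by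
      rw [leibniz_lie x y z, ← lie_skew ⁅x, z⁆ y]; abel
    rw [this]
    exact sub_mem (ih2 (i + a) _ (hV _ _ _ hx _ (hy1.mem hV)) (by rw [← hij]; abel))
      (ih1 (i + b) _ (hV _ _ _ hx _ (hy2.mem hV)) (by rw [← hij]; abel))
  | zero i => intro i x _ _; simp
  | add i x y _ _ ih1 ih2 =>
    intro a z hz h
    rw [lie_add]; exact add_mem (ih1 a z hz h) (ih2 a z hz h)
  | smul i r x _ ih =>
    intro a z hz h
    rw [lie_smul]; exact Submodule.smul_mem _ _ (ih a z hz h)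

/-- derived length bound -/
def fB (u : ℕ) : ℕ → ℕ
  | 0 => 0
  | k + 1 => fB u k + (fB u k + 1) * u

theorem Pstep [NeZero p] (u : ℕ) (k : ℕ) (hk : k ≤ p) : ∀ V : ZMod p → Submodule R L, Nice V →
    iterBra R (Set.univ : Set L) (V 0 : Set L) u = ⊥ → ∀ i, (Dfam^[fB u k] V) i ≤ genSub V k i := by
  induction k with
  | zero => intro V hV _ i x hx; exact Gen.base i x (Nat.zero_le _) hx
  | succ k ih =>
    intro V hV hu i
    specialize ih (by omega)
    have hypW : ∀ n, iterBra R (Set.univ : Set L) ((Dfam^[n] V) 0 : Set L) u = ⊥ := fun n =>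
      le_bot_iff.1 (hu ▸ iterBra_mono subset_rfl (Dit_le hV n 0) u)
    have A : ∀ W : ZMod p → Submodule R L, Nice W →
        iterBra R (Set.univ : Set L) (W 0 : Set L) u = ⊥ →
        (Dfam^[fB u k + 1] W) (k : ZMod p) ≤
          genSub W (k + 1) (k : ZMod p) ⊔ braSpan R (W (k : ZMod p)) (W 0) := by
      intro W hW hWu
      rw [Function.iterate_succ_apply']
      refine Submodule.span_le.2 ?_
      rintro z ⟨a, b, hab, x, hx, y, hy, rfl⟩
      exact lemmaB hW (by omega) (ih W hW hWu b hy) a x (Dit_le hW _ a hx) hab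
    have B : ∀ r, (Dfam^[(fB u k + 1) * r] V) (k : ZMod p) ≤
        genSub V (k + 1) (k : ZMod p) ⊔ iterBra R Set.univ (V 0 : Set L) r := by
      intro r
      induction r with
      | zero =>
        intro x _
        exact Submodule.mem_sup_right (Submodule.subset_span (Set.mem_univ x))
      | succ r ihr =>
        have e : (fB u k + 1) * (r + 1) = (fB u k + 1) + (fB u k + 1) * r := by ring
        rw [e, Function.iterate_add_apply]
        set n := (fB u k + 1) * r
        refine (A _ (Dit_nice hV n) (hypW n)).trans (sup_le ?_ (braSpan_le ?_))
        · refine le_trans ?_ le_sup_left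
          intro x hx
          exact Gen.trans (fun j hj w hw => Gen.base j w hj (Dit_le hV n j hw)) hx
        · intro x hx y hy
          obtain ⟨g, hg, t, ht, rfl⟩ := Submodule.mem_sup.1 (ihr hx)
          have hy' := Dit_le hV n 0 hy
          rw [add_lie]
          exact add_mem (Submodule.mem_sup_left (Gen.lie_zero hV hg y hy'))
            (Submodule.mem_sup_right (mem_braSpan ht hy'))
    have C := B u
    rw [hu, sup_bot_eq] at C
    intro x hx
    rw [fB, Function.iterate_add_apply] at hx
    set n := (fB u k + 1) * u
    refine Gen.trans (k := k) ?_ (ih _ (Dit_nice hV n) (hypW n) i hx)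
    intro j hj
    rcases hj.eq_or_lt with h | h
    · have hjk : j = (k : ZMod p) := by rw [h]; simp
      rw [hjk]; exact C
    · intro w hw; exact Gen.base j w h (Dit_le hV n j hw)

theorem Gen_top [NeZero p] {V : ZMod p → Submodule R L} {i : ZMod p} {x : L}
    (h : Gen V p i x) : x = 0 := by
  induction h with
  | base j x hj _ => have := ZMod.val_lt j; omega
  | bra _ _ _ _ _ _ ih1 _ => simp [ih1]
  | zero => rfl
  | add _ _ _ _ _ ih1 ih2 => simp [ih1, ih2]
  | smul _ _ _ _ ih => simp [ih]

theorem solvable [NeZero p] (u : ℕ) (V : ZMod p → Submodule R L) (hV : Nice V)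
    (hu : iterBra R (Set.univ : Set L) (V 0 : Set L) u = ⊥) (i : ZMod p) :
    (Dfam^[fB u p] V) i = ⊥ :=
  le_bot_iff.1 fun _ hx => Gen_top (Pstep u p le_rfl V hV hu i hx)

/-- iterated bracket of elements -/
def fl (x : L) (l : List L) : L := l.foldl (fun y z => ⁅y, z⁆) x

@[simp] theorem fl_nil (x : L) : fl x [] = x := rfl
@[simp] theorem fl_cons (x y : L) (l : List L) : fl x (y :: l) = fl ⁅x, y⁆ l := rfl
theorem fl_append (x : L) (l l' : List L) : fl x (l ++ l') = fl (fl x l) l' := by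
  simp [fl]

theorem fl_zero (l : List L) : fl (0 : L) l = 0 := by
  induction l with
  | nil => rfl
  | cons y l ih => simp [ih]

theorem fl_add (l : List L) : ∀ x y : L, fl (x + y) l = fl x l + fl y l := by
  induction l with
  | nil => intro x y; rfl
  | cons z l ih => intro x y; simp [ih]

theorem fl_sub (l : List L) : ∀ x y : L, fl (x - y) l = fl x l - fl y l := by
  induction l with
  | nil => intro x y; rfl
  | cons z l ih => intro x y; simp [ih]

theorem fl_smul (r : R) (l : List L) : ∀ x : L, fl (r • x) l = r • fl x l := by
  induction l with
  | nil => intro x; rfl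
  | cons z l ih => intro x; simp [ih]

theorem fl_mem (M : Submodule R L) (l : List L) : ∀ x ∈ M,
    (∀ y ∈ l, ∀ z ∈ M, ⁅z, y⁆ ∈ M) → fl x l ∈ M := by
  induction l with
  | nil => intro x hx _; exact hx
  | cons y l ih =>
    intro x hx h
    exact ih _ (h y (by simp) x hx) fun z hz => h z (by simp [hz])

theorem fl_mem_iterBra {S T : Set L} {x : L} (hx : x ∈ S) (l : List L) :
    (∀ y ∈ l, y ∈ T) → fl x l ∈ iterBra R S T l.length := by
  induction l using List.reverseRecOn with
  | nil => intro _; exact Submodule.subset_span hx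
  | append_singleton l y ih =>
    intro h
    rw [fl_append, List.length_append]
    exact mem_braSpan (ih fun z hz => h z (by simp [hz])) (h y (by simp))

theorem iterBra_le_fl {S T : Set L} (n : ℕ) :
    iterBra R S T n ≤
      Submodule.span R {z | ∃ x ∈ S, ∃ l : List L, (∀ y ∈ l, y ∈ T) ∧ l.length = n ∧ fl x l = z} := by
  induction n with
  | zero =>
    refine Submodule.span_mono ?_
    intro x hx
    exact ⟨x, hx, [], by simp, rfl, rfl⟩
  | succ n ih =>
    refine braSpan_le ?_
    intro x hx y hy
    replace hx := ih hx
    induction hx using Submodule.span_induction with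
    | mem z hz =>
      obtain ⟨w, hw, l, hl, hn, rfl⟩ := hz
      refine Submodule.subset_span ⟨w, hw, l ++ [y], ?_, by simp [hn], by rw [fl_append]; rfl⟩
      intro z hz
      rcases List.mem_append.1 hz with h | h
      · exact hl z h
      · rw [List.mem_singleton.1 h]; exact hy
    | zero => simp
    | add a b _ _ h1 h2 => rw [add_lie]; exact add_mem h1 h2
    | smul r a _ h => rw [smul_lie]; exact Submodule.smul_mem _ _ h

theorem fl_perm {T : Set L} {M M' : Submodule R L} (hM : ∀ y ∈ T, ∀ z ∈ M, ⁅z, y⁆ ∈ M)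
    (hM' : ∀ y ∈ T, ∀ z ∈ M', ⁅z, y⁆ ∈ M')
    (hc : ∀ x ∈ T, ∀ y ∈ T, ∀ z ∈ M, ⁅z, ⁅x, y⁆⁆ ∈ M') {l l' : List L} (h : l.Perm l') :
    ∀ g ∈ M, (∀ y ∈ l, y ∈ T) → fl g l - fl g l' ∈ M' := by
  induction h with
  | nil => intro g _ _; simp
  | cons x _ ih =>
    intro g hg hl
    exact ih _ (hM x (hl x (by simp)) g hg) fun y hy => hl y (by simp [hy])
  | swap x y l =>
    intro g hg hl
    have e : ⁅⁅g, y⁆, x⁆ - ⁅⁅g, x⁆, y⁆ = ⁅g, ⁅y, x⁆⁆ := by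
      rw [leibniz_lie g y x, ← lie_skew ⁅g, x⁆ y]; abel
    simp only [fl_cons]
    rw [← fl_sub, e]
    exact fl_mem M' l _ (hc y (hl y (by simp)) x (hl x (by simp)) g hg)
      fun z hz => hM' z (hl z (by simp [hz]))
  | trans h1 _ ih1 ih2 =>
    intro g hg hl
    have := add_mem (ih1 g hg hl) (ih2 g hg fun y hy => hl y (h1.mem_iff.2 hy))
    simpa using this

theorem pigeon [NeZero p] (V : ZMod p → Submodule R L) (m : ℕ) (l : List L)
    (hl : ∀ y ∈ l, y ∈ ⋃ i, (V i : Set L)) (hlen : p * m < l.length) :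
    ∃ a, ∃ l1 l2 : List L, l.Perm (l1 ++ l2) ∧ (∀ y ∈ l1, y ∈ V a) ∧ l1.length = m := by
  classical
  choose! d hd using fun y (hy : y ∈ l) => Set.mem_iUnion.1 (hl y hy)
  have hsum : ∑ a : ZMod p, (l.filter (fun y => d y = a)).length = l.length := by
    clear hl hd hlen
    induction l with
    | nil => simp
    | cons x l ih =>
      have : ∀ a, ((x :: l).filter (fun y => d y = a)).length =
          (l.filter (fun y => d y = a)).length + if d x = a then 1 else 0 := by
        intro a
        rw [List.filter_cons]
        by_cases h : d x = a <;> simp [h]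
      simp [this, Finset.sum_add_distrib, ih]
  obtain ⟨a, ha⟩ : ∃ a : ZMod p, m ≤ (l.filter (fun y => d y = a)).length := by
    by_contra! hcon
    have := Finset.sum_le_sum fun a (_ : a ∈ Finset.univ) => (hcon a).le
    rw [hsum] at this
    simp [ZMod.card] at this
    omega
  refine ⟨a, (l.filter (fun y => d y = a)).take m,
    (l.filter (fun y => d y = a)).drop m ++ l.filter (fun y => !decide (d y = a)), ?_, ?_, ?_⟩
  · rw [← List.append_assoc, List.take_append_drop]
    exact (List.filter_append_perm _ l).symm
  · intro y hy
    have := List.mem_filter.1 (List.mem_of_mem_take hy)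
    have h2 : d y = a := by simpa using this.2
    rw [← h2]; exact hd y this.1
  · simp [ha]

/-- nilpotency class bound -/
def cB (q : ℕ) : ℕ → ℕ
  | 0 => 0
  | s + 1 => 1 + cB q s * q

theorem iterBra_add {S T : Set L} (a b : ℕ) :
    iterBra R S T (a + b) = iterBra R (iterBra R S T a : Submodule R L) T b := by
  induction b with
  | zero => simp [iterBra]
  | succ b ih => rw [← add_assoc, iterBra, ih]; rfl

theorem nilp [NeZero p] (m : ℕ) (s : ℕ) : ∀ V : ZMod p → Submodule R L, Nice V →
    (∀ a, ∀ x : L, ∀ l : List L, (∀ y ∈ l, y ∈ V a) → l.length = m → fl x l = 0) →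
    (∀ i, (Dfam^[s] V) i = ⊥) →
    iterBra R (⋃ i, (V i : Set L)) (⋃ i, (V i : Set L)) (cB (p * m + 1) s) = ⊥ := by
  induction s with
  | zero =>
    intro V _ _ h0
    have h0' : ∀ i, V i = ⊥ := h0
    simp [cB, iterBra, h0']
  | succ s ih =>
    intro V hV hm hs
    have hW := Dfam_nice hV
    have hWV := Dfam_le hV
    have key := ih (Dfam V) hW
      (fun a x l hl hn => hm a x l (fun y hy => hWV a (hl y hy)) hn) (by simpa using hs)
    set S := ⋃ i, (Dfam V i : Set L) with hS
    set T := ⋃ i, (V i : Set L) with hT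
    have hTT : ∀ x ∈ T, ∀ y ∈ T, ⁅x, y⁆ ∈ S := by
      intro x hx y hy
      obtain ⟨a, ha⟩ := Set.mem_iUnion.1 hx
      obtain ⟨b, hb⟩ := Set.mem_iUnion.1 hy
      exact Set.mem_iUnion.2 ⟨a + b, mem_Dfam ha hb⟩
    have hST : S ⊆ T := Set.iUnion_mono fun i => hWV i
    have hinv : ∀ t, ∀ y ∈ T, ∀ z ∈ iterBra R S S t, ⁅z, y⁆ ∈ iterBra R S S t := by
      intro t
      induction t with
      | zero =>
        intro y hy z hz
        change z ∈ Submodule.span R S at hz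
        change ⁅z, y⁆ ∈ Submodule.span R S
        induction hz using Submodule.span_induction with
        | mem z hz => exact Submodule.subset_span (hTT z (hST hz) y hy)
        | zero => simp
        | add a b _ _ h1 h2 => rw [add_lie]; exact add_mem h1 h2
        | smul r a _ h => rw [smul_lie]; exact Submodule.smul_mem _ _ h
      | succ t iht =>
        intro y hy z hz
        change z ∈ Submodule.span R _ at hz
        induction hz using Submodule.span_induction with
        | mem z hz =>
          obtain ⟨g, hg, w, hw, rfl⟩ := hz
          have : ⁅⁅g, w⁆, y⁆ = ⁅⁅g, y⁆, w⁆ + ⁅g, ⁅w, y⁆⁆ := by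
            rw [lie_lie g w y, ← lie_skew ⁅g, y⁆ w]; abel
          rw [this]
          exact add_mem (mem_braSpan (iht y hy g hg) hw)
            (mem_braSpan hg (hTT w (hST hw) y hy))
        | zero => simp
        | add a b _ _ h1 h2 => rw [add_lie]; exact add_mem h1 h2
        | smul r a _ h => rw [smul_lie]; exact Submodule.smul_mem _ _ h
    have hstep : ∀ t, iterBra R (iterBra R S S t : Submodule R L) T (p * m + 1) ≤
        iterBra R S S (t + 1) := by
      intro t
      refine (iterBra_le_fl _).trans (Submodule.span_le.2 ?_)
      rintro z ⟨g, hg, l, hl, hn, rfl⟩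
      obtain ⟨a, l1, l2, hperm, h1, h2⟩ := pigeon V m l hl (by omega)
      have := fl_perm (hinv t) (hinv (t + 1))
        (fun x hx y hy z hz => mem_braSpan hz (hTT x hx y hy)) hperm g hg hl
      rw [fl_append, hm a g l1 h1 h2, fl_zero, sub_zero] at this
      exact this
    have hall : ∀ t, iterBra R T T (1 + t * (p * m + 1)) ≤ iterBra R S S t := by
      intro t
      induction t with
      | zero =>
        rw [Nat.zero_mul]
        change braSpan R (Submodule.span R T : Set L) T ≤ Submodule.span R S
        refine braSpan_le ?_
        intro z hz y hy
        change z ∈ Submodule.span R T at hz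
        induction hz using Submodule.span_induction with
        | mem z hz => exact Submodule.subset_span (hTT z hz y hy)
        | zero => simp
        | add a b _ _ h1 h2 => rw [add_lie]; exact add_mem h1 h2
        | smul r a _ h => rw [smul_lie]; exact Submodule.smul_mem _ _ h
      | succ t iht =>
        rw [show 1 + (t + 1) * (p * m + 1) = (1 + t * (p * m + 1)) + (p * m + 1) by ring,
          iterBra_add]
        exact (iterBra_mono iht subset_rfl _).trans (hstep t)
    exact le_bot_iff.1 ((hall _).trans key.le)

theorem iterBra_univ_le {T : Set L} (hT : Submodule.span R T = ⊤) (n : ℕ) :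
    iterBra R (Set.univ : Set L) (Set.univ : Set L) n ≤ iterBra R T T n := by
  induction n with
  | zero => change _ ≤ Submodule.span R T; rw [hT]; exact le_top
  | succ n ih =>
    refine braSpan_le ?_
    intro x hx y _
    have hy : y ∈ Submodule.span R T := hT ▸ Submodule.mem_top
    induction hy using Submodule.span_induction with
    | mem y hy => exact mem_braSpan (ih hx) hy
    | zero => simp
    | add a b _ _ h1 h2 => rw [lie_add]; exact add_mem (h1 trivial) (h2 trivial)
    | smul r a _ h => rw [lie_smul]; exact Submodule.smul_mem _ _ (h trivial)

theorem fl_deg {V : ZMod p → Submodule R L} (hV : Nice V) (a : ZMod p) (l : List L) :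
    ∀ (b : ZMod p) (x : L), x ∈ V b → (∀ y ∈ l, y ∈ V a) → fl x l ∈ V (b + l.length * a) := by
  induction l with
  | nil => intro b x hx _; simpa using hx
  | cons y l ih =>
    intro b x hx hl
    have := ih _ _ (hV _ _ _ hx _ (hl y (by simp))) fun z hz => hl z (by simp [hz])
    rw [fl_cons]
    convert this using 2
    push_cast [List.length_cons]; ring

theorem ad_nilp (hp : p.Prime) {u v : ℕ} {V : ZMod p → Submodule R L} (hV : Nice V)
    (hT : Submodule.span R (⋃ i, (V i : Set L)) = ⊤)
    (h0 : iterBra R (Set.univ : Set L) (V 0 : Set L) u = ⊥)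
    (h1 : ∀ a : ZMod p,
        iterBra R ((braSpan R Set.univ Set.univ ⊓ V 0 : Submodule R L) : Set L)
          (V a : Set L) v = ⊥) (a : ZMod p) (x : L) (l : List L) (hl : ∀ y ∈ l, y ∈ V a)
    (hlen : l.length = u + (p + p) + v) : fl x l = 0 := by
  haveI := Fact.mk hp
  by_cases ha : a = 0
  · subst ha
    rw [← List.take_append_drop u l, fl_append]
    have := fl_mem_iterBra (R := R) (S := Set.univ) (T := (V 0 : Set L)) (Set.mem_univ x)
      (l.take u) fun y hy => hl y (List.mem_of_mem_take hy)
    rw [List.length_take, min_eq_left (by omega), h0, Submodule.mem_bot] at this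
    rw [this, fl_zero]
  · have hx : x ∈ Submodule.span R (⋃ i, (V i : Set L)) := hT ▸ Submodule.mem_top
    induction hx using Submodule.span_induction with
    | zero => exact fl_zero l
    | add y z _ _ h1 h2 => rw [fl_add, h1, h2, add_zero]
    | smul r y _ h => rw [fl_smul, h, smul_zero]
    | mem x hx =>
      obtain ⟨b, hb⟩ := Set.mem_iUnion.1 hx
      set t := (-b / a).val + p with ht
      have htp : (-b / a).val < p := ZMod.val_lt _
      have hpp := hp.pos
      have hdeg := fl_deg hV a (l.take t) b x hb fun y hy => hl y (List.mem_of_mem_take hy)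
      rw [List.length_take, min_eq_left (by omega)] at hdeg
      have e : b + (t : ZMod p) * a = 0 := by
        rw [ht]; push_cast; simp; field_simp; ring
      rw [e] at hdeg
      have hbr : fl x (l.take t) ∈ braSpan R (Set.univ : Set L) Set.univ := by
        have hne : l.take t ≠ [] := by
          intro h
          have := congrArg List.length h
          rw [List.length_take, min_eq_left (by omega)] at this
          simp at this; omega
        rw [← List.dropLast_append_getLast hne, fl_append]
        exact mem_braSpan (Set.mem_univ _) (Set.mem_univ _)
      have hl' : l = l.take t ++ ((l.drop t).take v ++ (l.drop t).drop v) := by simp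
      rw [hl', fl_append, fl_append]
      have := fl_mem_iterBra (R := R)
        (S := ((braSpan R Set.univ Set.univ ⊓ V 0 : Submodule R L) : Set L))
        (T := (V a : Set L)) ⟨hbr, hdeg⟩
        ((l.drop t).take v) fun y hy => hl y (List.mem_of_mem_drop (List.mem_of_mem_take hy))
      rw [List.length_take, List.length_drop, min_eq_left (by omega), h1,
        Submodule.mem_bot] at this
      rw [this, fl_zero]

end Helpers

/-- For every prime `p` and positive integers `u`, `v` there is `N = N(p, u, v)` such that:
if `L = ⊕_{i ∈ ℤ/pℤ} L_i` is a `ℤ/pℤ`-graded Lie algebra with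
`[L, L_0, …, L_0] = 0` (`L_0` occurring `u` times) and
`[[L, L] ∩ L_0, L_a, …, L_a] = 0` (`L_a` occurring `v` times) for every `a ∈ ℤ/pℤ`,
then `L` is nilpotent of class at most `N` (i.e. all left-normed brackets with `N + 1`
entries vanish). -/
theorem graded_lie_algebra_nilpotency_criterion
    (p u v : ℕ) (hp : p.Prime) (hu : 0 < u) (hv : 0 < v) :
    ∃ N : ℕ, ∀ (R : Type*) [CommRing R] (L : Type*) [LieRing L] [LieAlgebra R L]
      (V : ZMod p → Submodule R L),
      DirectSum.IsInternal V →
      (∀ i j : ZMod p, ∀ x ∈ V i, ∀ y ∈ V j, ⁅x, y⁆ ∈ V (i + j)) →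
      iterBra R (Set.univ : Set L) (V 0 : Set L) u = ⊥ →
      (∀ a : ZMod p,
        iterBra R ((braSpan R Set.univ Set.univ ⊓ V 0 : Submodule R L) : Set L)
          (V a : Set L) v = ⊥) →
      iterBra R (Set.univ : Set L) (Set.univ : Set L) N = ⊥ := by
  haveI : NeZero p := ⟨hp.ne_zero⟩
  refine ⟨cB (p * (u + (p + p) + v) + 1) (fB u p), ?_⟩
  intro R _ L _ _ V hint hV h0 h1
  have hT : Submodule.span R (⋃ i, (V i : Set L)) = ⊤ := by
    rw [Submodule.span_iUnion]
    simpa using hint.submodule_iSup_eq_top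
  refine le_bot_iff.1 ((iterBra_univ_le hT _).trans ?_)
  exact (nilp _ _ V hV (fun a x l hl hn => ad_nilp hp hV hT h0 h1 a x l hl hn)
    (fun i => solvable u V hV h0 i)).le
end
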